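/- (Smoothness on sublevel sets.) For every α > 0: (i) for every K ∈ 𝕂_α and every direction tuple E with ‖E‖₂ = 1, the second directional derivative satisfies |(d²/dt²)|_{t=0} C(K + tE)| ≤ L(α); and (ii) for any policies K, K' such that t·K' + (1−t)·K ∈ 𝕂_α for all t ∈ [0,1], one has C(K') ≤ C(K) + ⟨∇C(K), K' − K⟩ + (L(α)/2)·‖K' − K‖₂². -/

import Mathlib

open Matrix Filter
open scoped Kronecker Topology

namespace MJLS

noncomputable section

attribute [local instance] Classical.propDecidable

/-- Closed-loop matrices `Γ i = A i - B i * K i`. -/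
def Gam {d k N : ℕ} (A : Fin N → Matrix (Fin d) (Fin d) ℝ)
    (B : Fin N → Matrix (Fin d) (Fin k) ℝ)
    (K : Fin N → Matrix (Fin k) (Fin d) ℝ) : Fin N → Matrix (Fin d) (Fin d) ℝ :=
  fun i => A i - B i * K i

/-- The operator `E_i(V) = ∑ j, p i j • V j`. -/
def opE {d N : ℕ} (Pr : Matrix (Fin N) (Fin N) ℝ)
    (V : Fin N → Matrix (Fin d) (Fin d) ℝ) : Fin N → Matrix (Fin d) (Fin d) ℝ :=
  fun i => ∑ j, Pr i j • V j

/-- The matrix `𝒜 = diag(Γᵀ ⊗ Γᵀ) (P ⊗ I)`. -/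
def calA {d N : ℕ} (Pr : Matrix (Fin N) (Fin N) ℝ)
    (Γ : Fin N → Matrix (Fin d) (Fin d) ℝ) :
    Matrix (Fin N × Fin d × Fin d) (Fin N × Fin d × Fin d) ℝ :=
  (Matrix.reindex (Equiv.prodComm (Fin d × Fin d) (Fin N))
      (Equiv.prodComm (Fin d × Fin d) (Fin N))
      (Matrix.blockDiagonal fun i => (Γ i)ᵀ ⊗ₖ (Γ i)ᵀ)) *
    (Pr ⊗ₖ (1 : Matrix (Fin d × Fin d) (Fin d × Fin d) ℝ))

/-- `K` is mean-square stabilizing: the spectral radius of `𝒜` is less than `1`. -/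
def MSS {d k N : ℕ} (Pr : Matrix (Fin N) (Fin N) ℝ)
    (A : Fin N → Matrix (Fin d) (Fin d) ℝ) (B : Fin N → Matrix (Fin d) (Fin k) ℝ)
    (K : Fin N → Matrix (Fin k) (Fin d) ℝ) : Prop :=
  spectralRadius ℂ ((calA Pr (Gam A B K)).map (algebraMap ℝ ℂ)) < 1

/-- `P` solves the coupled Lyapunov equations for the policy `K`. -/
def IsLyap {d k N : ℕ} (Pr : Matrix (Fin N) (Fin N) ℝ)
    (A : Fin N → Matrix (Fin d) (Fin d) ℝ) (B : Fin N → Matrix (Fin d) (Fin k) ℝ)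
    (Q : Fin N → Matrix (Fin d) (Fin d) ℝ) (R : Fin N → Matrix (Fin k) (Fin k) ℝ)
    (K : Fin N → Matrix (Fin k) (Fin d) ℝ)
    (P : Fin N → Matrix (Fin d) (Fin d) ℝ) : Prop :=
  ∀ i, P i = Q i + (K i)ᵀ * R i * K i + (Gam A B K i)ᵀ * opE Pr P i * Gam A B K i

/-- `P^K`, the (for mean-square stabilizing `K`, unique) solution of the coupled
Lyapunov equations. -/
def PK {d k N : ℕ} (Pr : Matrix (Fin N) (Fin N) ℝ)
    (A : Fin N → Matrix (Fin d) (Fin d) ℝ) (B : Fin N → Matrix (Fin d) (Fin k) ℝ)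
    (Q : Fin N → Matrix (Fin d) (Fin d) ℝ) (R : Fin N → Matrix (Fin k) (Fin k) ℝ)
    (K : Fin N → Matrix (Fin k) (Fin d) ℝ) : Fin N → Matrix (Fin d) (Fin d) ℝ :=
  if h : ∃ P, IsLyap Pr A B Q R K P then h.choose else 0

/-- The LQR cost `C(K) = ∑ i, π i * tr(P^K_i Sg)`. -/
def cost {d k N : ℕ} (Pr : Matrix (Fin N) (Fin N) ℝ)
    (A : Fin N → Matrix (Fin d) (Fin d) ℝ) (B : Fin N → Matrix (Fin d) (Fin k) ℝ)
    (Q : Fin N → Matrix (Fin d) (Fin d) ℝ) (R : Fin N → Matrix (Fin k) (Fin k) ℝ)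
    (piv : Fin N → ℝ) (Sg : Matrix (Fin d) (Fin d) ℝ)
    (K : Fin N → Matrix (Fin k) (Fin d) ℝ) : ℝ :=
  ∑ i, piv i * (PK Pr A B Q R K i * Sg).trace

/-- The operator `T_j(V) = ∑ i, p i j • (Γ i * V i * Γ iᵀ)`. -/
def opT {d N : ℕ} (Pr : Matrix (Fin N) (Fin N) ℝ)
    (Γ : Fin N → Matrix (Fin d) (Fin d) ℝ)
    (V : Fin N → Matrix (Fin d) (Fin d) ℝ) : Fin N → Matrix (Fin d) (Fin d) ℝ :=
  fun j => ∑ i, Pr i j • (Γ i * V i * (Γ i)ᵀ)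

/-- `𝐗^K = ∑_{t=0}^∞ T^t(X(0))` with `X_i(0) = π i • Sg`. -/
def XK {d N : ℕ} (Pr : Matrix (Fin N) (Fin N) ℝ) (piv : Fin N → ℝ)
    (Sg : Matrix (Fin d) (Fin d) ℝ) (Γ : Fin N → Matrix (Fin d) (Fin d) ℝ) :
    Fin N → Matrix (Fin d) (Fin d) ℝ :=
  ∑' t : ℕ, (opT Pr Γ)^[t] (fun i => piv i • Sg)

/-- `L^K_i = (R i + B iᵀ E_i(P^K) B i) K i - B iᵀ E_i(P^K) A i`. -/
def LK {d k N : ℕ} (Pr : Matrix (Fin N) (Fin N) ℝ)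
    (A : Fin N → Matrix (Fin d) (Fin d) ℝ) (B : Fin N → Matrix (Fin d) (Fin k) ℝ)
    (Q : Fin N → Matrix (Fin d) (Fin d) ℝ) (R : Fin N → Matrix (Fin k) (Fin k) ℝ)
    (K : Fin N → Matrix (Fin k) (Fin d) ℝ) : Fin N → Matrix (Fin k) (Fin d) ℝ :=
  fun i => (R i + (B i)ᵀ * opE Pr (PK Pr A B Q R K) i * B i) * K i
    - (B i)ᵀ * opE Pr (PK Pr A B Q R K) i * A i

/-- The operator `L_i(V) = Γ iᵀ E_i(V) Γ i`. -/
def opL {d N : ℕ} (Pr : Matrix (Fin N) (Fin N) ℝ)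
    (Γ : Fin N → Matrix (Fin d) (Fin d) ℝ)
    (V : Fin N → Matrix (Fin d) (Fin d) ℝ) : Fin N → Matrix (Fin d) (Fin d) ℝ :=
  fun i => (Γ i)ᵀ * opE Pr V i * Γ i

/-- `(P^K)'[E] = ∑_{t=0}^∞ L^t(Eᵀ L^K + (L^K)ᵀ E)`. -/
def PKd {d k N : ℕ} (Pr : Matrix (Fin N) (Fin N) ℝ)
    (Γ : Fin N → Matrix (Fin d) (Fin d) ℝ)
    (Lk E : Fin N → Matrix (Fin k) (Fin d) ℝ) : Fin N → Matrix (Fin d) (Fin d) ℝ :=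
  ∑' t : ℕ, (opL Pr Γ)^[t] (fun i => (E i)ᵀ * Lk i + (Lk i)ᵀ * E i)

/-- `‖V‖₂² = ∑ i, tr(V iᵀ V i)`. -/
def norm2sq {a b N : ℕ} (V : Fin N → Matrix (Fin a) (Fin b) ℝ) : ℝ :=
  ∑ i, ((V i)ᵀ * V i).trace

/-- The inner product `⟨V, S⟩ = ∑ i, tr(V iᵀ S i)`. -/
def ip {a b N : ℕ} (V S : Fin N → Matrix (Fin a) (Fin b) ℝ) : ℝ :=
  ∑ i, ((V i)ᵀ * S i).trace

/-- The spectral norm (maximal singular value) of a matrix. -/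
def specNorm {a b : ℕ} (M : Matrix (Fin a) (Fin b) ℝ) : ℝ :=
  ⨆ x : {x : EuclideanSpace ℝ (Fin b) // ‖x‖ ≤ 1}, ‖Matrix.toEuclideanLin M x.1‖

/-- The minimal singular value of a square matrix. -/
def sigmaMin {a : ℕ} (M : Matrix (Fin a) (Fin a) ℝ) : ℝ :=
  ⨅ x : {x : EuclideanSpace ℝ (Fin a) // ‖x‖ = 1}, ‖Matrix.toEuclideanLin M x.1‖

/-- `‖V‖_max = max_i ‖V i‖` (spectral norms). -/
def maxNorm {a b N : ℕ} (V : Fin N → Matrix (Fin a) (Fin b) ℝ) : ℝ :=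
  ⨆ i, specNorm (V i)

/-- `Λ_min(V) = min_i σ_min(V i)`. -/
def lamMin {a N : ℕ} (V : Fin N → Matrix (Fin a) (Fin a) ℝ) : ℝ :=
  ⨅ i, sigmaMin (V i)

/-- `μ = (min_i π i) · σ_min(Sg)`. -/
def mu {d N : ℕ} (piv : Fin N → ℝ) (Sg : Matrix (Fin d) (Fin d) ℝ) : ℝ :=
  (⨅ i, piv i) * sigmaMin Sg

/-- `ξ(α) = (1/Λ_min(Q))·((1 + ‖B‖²_max)·α/μ + ‖R‖_max) − 1`. -/
def xi {d k N : ℕ} (B : Fin N → Matrix (Fin d) (Fin k) ℝ)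
    (R : Fin N → Matrix (Fin k) (Fin k) ℝ) (Q : Fin N → Matrix (Fin d) (Fin d) ℝ)
    (piv : Fin N → ℝ) (Sg : Matrix (Fin d) (Fin d) ℝ) (α : ℝ) : ℝ :=
  (1 / lamMin Q) * ((1 + maxNorm B ^ 2) * α / mu piv Sg + maxNorm R) - 1

/-- The smoothness constant
`L(α) = 2·(‖R‖_max + ‖B‖²_max·(1 + 2ξ(α)/‖B‖_max)·α/μ)·α/Λ_min(Q)`. -/
def Lsm {d k N : ℕ} (B : Fin N → Matrix (Fin d) (Fin k) ℝ)
    (R : Fin N → Matrix (Fin k) (Fin k) ℝ) (Q : Fin N → Matrix (Fin d) (Fin d) ℝ)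
    (piv : Fin N → ℝ) (Sg : Matrix (Fin d) (Fin d) ℝ) (α : ℝ) : ℝ :=
  2 * (maxNorm R + maxNorm B ^ 2 * (1 + 2 * xi B R Q piv Sg α / maxNorm B)
      * α / mu piv Sg) * α / lamMin Q

end


/-! ### Spectral norm and minimal singular value -/

lemma norm_toLp_sq {a : ℕ} (x : Fin a → ℝ) :
    ‖(WithLp.toLp 2 x : EuclideanSpace ℝ (Fin a))‖ ^ 2 = x ⬝ᵥ x := by
  rw [EuclideanSpace.real_norm_sq_eq]
  simp [dotProduct, sq]

lemma dot_self_nonneg {a : ℕ} (x : Fin a → ℝ) : 0 ≤ x ⬝ᵥ x := by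
  rw [← norm_toLp_sq]; positivity

lemma specNorm_bdd {a b : ℕ} (M : Matrix (Fin a) (Fin b) ℝ) :
    BddAbove (Set.range fun x : {x : EuclideanSpace ℝ (Fin b) // ‖x‖ ≤ 1} =>
      ‖Matrix.toEuclideanLin M x.1‖) := by
  refine ⟨‖LinearMap.toContinuousLinearMap (Matrix.toEuclideanLin M)‖, ?_⟩
  rintro _ ⟨x, rfl⟩
  have h := (LinearMap.toContinuousLinearMap (Matrix.toEuclideanLin M)).le_opNorm x.1
  have h2 := x.2
  refine le_trans h ?_
  exact mul_le_of_le_one_right (norm_nonneg _) h2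

lemma specNorm_nonneg {a b : ℕ} (M : Matrix (Fin a) (Fin b) ℝ) : 0 ≤ specNorm M :=
  Real.iSup_nonneg fun _ => norm_nonneg _

lemma specNorm_le' {a b : ℕ} (M : Matrix (Fin a) (Fin b) ℝ) (x : EuclideanSpace ℝ (Fin b)) :
    ‖Matrix.toEuclideanLin M x‖ ≤ specNorm M * ‖x‖ := by
  by_cases hx : x = 0
  · subst hx; simp
  have hx' : 0 < ‖x‖ := norm_pos_iff.mpr hx
  have h1 : ‖(‖x‖⁻¹ • x : EuclideanSpace ℝ (Fin b))‖ ≤ 1 := by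
    rw [norm_smul, norm_inv, norm_norm, inv_mul_cancel₀ hx'.ne']
  have h := le_ciSup (specNorm_bdd M) ⟨_, h1⟩
  change _ ≤ specNorm M at h
  simp only [map_smul, norm_smul, norm_inv, norm_norm] at h
  rw [inv_mul_le_iff₀ hx'] at h
  linarith

lemma specNorm_sq {a b : ℕ} (M : Matrix (Fin a) (Fin b) ℝ) (x : Fin b → ℝ) :
    (M *ᵥ x) ⬝ᵥ (M *ᵥ x) ≤ specNorm M ^ 2 * (x ⬝ᵥ x) := by
  rw [← norm_toLp_sq, ← norm_toLp_sq, ← mul_pow]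
  have := specNorm_le' M (WithLp.toLp 2 x)
  exact pow_le_pow_left₀ (norm_nonneg _) this 2

lemma inner_toLp {a : ℕ} (x y : Fin a → ℝ) :
    inner ℝ (WithLp.toLp 2 x : EuclideanSpace ℝ (Fin a)) (WithLp.toLp 2 y) = x ⬝ᵥ y := by
  rw [EuclideanSpace.inner_eq_star_dotProduct]
  simp [dotProduct_comm]

lemma quad_le_specNorm {a : ℕ} (M : Matrix (Fin a) (Fin a) ℝ) (x : Fin a → ℝ) :
    x ⬝ᵥ M *ᵥ x ≤ specNorm M * (x ⬝ᵥ x) := by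
  rw [← inner_toLp, ← norm_toLp_sq]
  have h1 := real_inner_le_norm (WithLp.toLp 2 x : EuclideanSpace ℝ (Fin a))
    (WithLp.toLp 2 (M *ᵥ x))
  have h2 := specNorm_le' M (WithLp.toLp 2 x)
  change ‖(WithLp.toLp 2 (M *ᵥ x) : EuclideanSpace ℝ (Fin a))‖ ≤ _ at h2
  nlinarith [norm_nonneg (WithLp.toLp 2 x : EuclideanSpace ℝ (Fin a))]

lemma eig_expand {a : ℕ} {M : Matrix (Fin a) (Fin a) ℝ} (hM : M.IsHermitian) (x : Fin a → ℝ) :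
    x ⬝ᵥ M *ᵥ x = ∑ i, hM.eigenvalues i *
      (inner ℝ (hM.eigenvectorBasis i) (WithLp.toLp 2 x : EuclideanSpace ℝ (Fin a))) ^ 2 := by
  rw [← inner_toLp, ← OrthonormalBasis.sum_inner_mul_inner hM.eigenvectorBasis]
  refine Finset.sum_congr rfl fun i _ => ?_
  have h : inner ℝ (hM.eigenvectorBasis i) (WithLp.toLp 2 (M *ᵥ x) : EuclideanSpace ℝ (Fin a))
      = hM.eigenvalues i * inner ℝ (hM.eigenvectorBasis i)
        (WithLp.toLp 2 x : EuclideanSpace ℝ (Fin a)) := by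
    have h0 : (hM.eigenvectorBasis i) = WithLp.toLp 2 (⇑(hM.eigenvectorBasis i)) := rfl
    rw [h0, inner_toLp, inner_toLp, dotProduct_mulVec, ← mulVec_transpose]
    have : Mᵀ = M := (by simpa using hM : M.IsSymm)
    rw [this, hM.mulVec_eigenvectorBasis, smul_dotProduct, smul_eq_mul]
  rw [h, real_inner_comm]; ring

lemma nsq_expand {a : ℕ} {M : Matrix (Fin a) (Fin a) ℝ} (hM : M.IsHermitian) (x : Fin a → ℝ) :
    x ⬝ᵥ x = ∑ i,
      (inner ℝ (hM.eigenvectorBasis i) (WithLp.toLp 2 x : EuclideanSpace ℝ (Fin a))) ^ 2 := by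
  rw [← inner_toLp, ← OrthonormalBasis.sum_inner_mul_inner hM.eigenvectorBasis]
  refine Finset.sum_congr rfl fun i _ => ?_
  rw [real_inner_comm]; ring

lemma sigmaMin_bdd {a : ℕ} (M : Matrix (Fin a) (Fin a) ℝ) :
    BddBelow (Set.range fun x : {x : EuclideanSpace ℝ (Fin a) // ‖x‖ = 1} =>
      ‖Matrix.toEuclideanLin M x.1‖) := ⟨0, by rintro _ ⟨x, rfl⟩; exact norm_nonneg _⟩

lemma sigmaMin_le_eig {a : ℕ} {M : Matrix (Fin a) (Fin a) ℝ} (hM : M.PosDef) (i : Fin a) :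
    sigmaMin M ≤ hM.1.eigenvalues i := by
  have h1 : ‖hM.1.eigenvectorBasis i‖ = 1 := hM.1.eigenvectorBasis.norm_eq_one i
  refine (ciInf_le (sigmaMin_bdd M) ⟨_, h1⟩).trans ?_
  have : Matrix.toEuclideanLin M (hM.1.eigenvectorBasis i)
      = hM.1.eigenvalues i • hM.1.eigenvectorBasis i := by
    have := hM.1.mulVec_eigenvectorBasis i
    exact congrArg (WithLp.toLp 2) this
  simp only [this, norm_smul, h1, mul_one, Real.norm_eq_abs, abs_of_pos (hM.eigenvalues_pos i)]
  exact le_rfl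

lemma sigmaMin_quad {a : ℕ} {M : Matrix (Fin a) (Fin a) ℝ} (hM : M.PosDef) (x : Fin a → ℝ) :
    sigmaMin M * (x ⬝ᵥ x) ≤ x ⬝ᵥ M *ᵥ x := by
  rw [eig_expand hM.1, nsq_expand hM.1, Finset.mul_sum]
  exact Finset.sum_le_sum fun i _ =>
    mul_le_mul_of_nonneg_right (sigmaMin_le_eig hM i) (sq_nonneg _)

lemma sigmaMin_pos {a : ℕ} (ha : 0 < a) {M : Matrix (Fin a) (Fin a) ℝ} (hM : M.PosDef) :
    0 < sigmaMin M := by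
  have : Nonempty (Fin a) := ⟨⟨0, ha⟩⟩
  obtain ⟨i0, hi0⟩ := Finite.exists_min hM.1.eigenvalues
  refine lt_of_lt_of_le (hM.eigenvalues_pos i0) ?_
  have : Nonempty {x : EuclideanSpace ℝ (Fin a) // ‖x‖ = 1} :=
    ⟨⟨hM.1.eigenvectorBasis i0, hM.1.eigenvectorBasis.norm_eq_one i0⟩⟩
  refine le_ciInf fun ⟨x, hx⟩ => ?_
  have h1 : hM.1.eigenvalues i0 * (x.ofLp ⬝ᵥ x.ofLp) ≤ x.ofLp ⬝ᵥ M *ᵥ x.ofLp := by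
    rw [eig_expand hM.1, nsq_expand hM.1, Finset.mul_sum]
    exact Finset.sum_le_sum fun i _ => mul_le_mul_of_nonneg_right (hi0 i) (sq_nonneg _)
  have h2 : x.ofLp ⬝ᵥ x.ofLp = 1 := by
    rw [← norm_toLp_sq]; change ‖x‖ ^ 2 = 1; rw [hx]; norm_num
  have h3 := real_inner_le_norm x (WithLp.toLp 2 (M *ᵥ x.ofLp))
  have h4 := inner_toLp x.ofLp (M *ᵥ x.ofLp)
  change inner ℝ x _ = _ at h4
  rw [h4, hx] at h3
  change _ ≤ ‖(WithLp.toLp 2 (M *ᵥ x.ofLp) : EuclideanSpace ℝ (Fin a))‖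
  rw [h2] at h1
  linarith

lemma le_maxNorm {a b N : ℕ} (V : Fin N → Matrix (Fin a) (Fin b) ℝ) (i : Fin N) :
    specNorm (V i) ≤ maxNorm V :=
  le_ciSup (f := fun i => specNorm (V i)) (Set.finite_range _).bddAbove i

lemma maxNorm_nonneg {a b N : ℕ} (V : Fin N → Matrix (Fin a) (Fin b) ℝ) : 0 ≤ maxNorm V :=
  Real.iSup_nonneg fun _ => specNorm_nonneg _

lemma lamMin_le {a N : ℕ} (V : Fin N → Matrix (Fin a) (Fin a) ℝ) (i : Fin N) :
    lamMin V ≤ sigmaMin (V i) :=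
  ciInf_le (f := fun i => sigmaMin (V i)) (Set.finite_range _).bddBelow i

lemma lamMin_pos {a N : ℕ} (ha : 0 < a) (hN : 0 < N) (V : Fin N → Matrix (Fin a) (Fin a) ℝ)
    (hV : ∀ i, (V i).PosDef) : 0 < lamMin V := by
  have : Nonempty (Fin N) := ⟨⟨0, hN⟩⟩
  obtain ⟨i0, hi0⟩ := Finite.exists_min fun i => sigmaMin (V i)
  exact lt_of_lt_of_le (sigmaMin_pos ha (hV i0)) (le_ciInf hi0)

lemma mu_pos {d N : ℕ} (hd : 0 < d) (hN : 0 < N) (piv : Fin N → ℝ) (hpiv : ∀ i, 0 < piv i)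
    (Sg : Matrix (Fin d) (Fin d) ℝ) (hSg : Sg.PosDef) : 0 < mu piv Sg := by
  have : Nonempty (Fin N) := ⟨⟨0, hN⟩⟩
  obtain ⟨i0, hi0⟩ := Finite.exists_min piv
  exact mul_pos (lt_of_lt_of_le (hpiv i0) (le_ciInf hi0)) (sigmaMin_pos hd hSg)

lemma mu_quad {d N : ℕ} (piv : Fin N → ℝ) (hd : 0 < d)
    (Sg : Matrix (Fin d) (Fin d) ℝ) (hSg : Sg.PosDef) (hpiv : ∀ i, 0 < piv i)
    (i : Fin N) (x : Fin d → ℝ) :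
    mu piv Sg * (x ⬝ᵥ x) ≤ piv i * (x ⬝ᵥ Sg *ᵥ x) := by
  have h1 : (⨅ i, piv i) ≤ piv i := ciInf_le (Set.finite_range _).bddBelow i
  have h2 := sigmaMin_quad hSg x
  have h3 := mul_nonneg (sigmaMin_pos hd hSg).le (dot_self_nonneg x)
  calc mu piv Sg * (x ⬝ᵥ x) = (⨅ i, piv i) * (sigmaMin Sg * (x ⬝ᵥ x)) := by unfold mu; ring
    _ ≤ piv i * (sigmaMin Sg * (x ⬝ᵥ x)) := mul_le_mul_of_nonneg_right h1 h3
    _ ≤ _ := mul_le_mul_of_nonneg_left h2 (hpiv i).le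

/-- trace of the product of a matrix with nonnegative quadratic form and a PSD matrix -/
lemma trace_mul_nonneg {d : ℕ} (V M : Matrix (Fin d) (Fin d) ℝ)
    (hV : ∀ x : Fin d → ℝ, 0 ≤ x ⬝ᵥ V *ᵥ x) (hM : M.PosSemidef) : 0 ≤ (V * M).trace := by
  obtain ⟨m, w, hw⟩ := Matrix.posSemidef_iff_eq_sum_vecMulVec.mp hM
  rw [hw, Finset.mul_sum, Matrix.trace_sum]
  refine Finset.sum_nonneg fun j _ => ?_
  have := hV (w j)
  rw [Matrix.mul_vecMulVec, Matrix.trace_vecMulVec, dotProduct_comm]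
  simpa using this

/-! ### The Lyapunov operators -/

/-- `V ↦ (Gᵢᵀ Eᵢ(V) Hᵢ)ᵢ` as a linear map. -/
noncomputable def biL {d N : ℕ} (Pr : Matrix (Fin N) (Fin N) ℝ)
    (G H : Fin N → Matrix (Fin d) (Fin d) ℝ) :
    (Fin N → Matrix (Fin d) (Fin d) ℝ) →ₗ[ℝ] (Fin N → Matrix (Fin d) (Fin d) ℝ) where
  toFun V := fun i => (G i)ᵀ * opE Pr V i * H i
  map_add' V W := by
    funext i
    simp [opE, Finset.sum_add_distrib, Matrix.mul_add, Matrix.add_mul]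
  map_smul' c V := by
    funext i
    have : opE Pr (c • V) i = c • opE Pr V i := by
      simp only [opE, Pi.smul_apply, Finset.smul_sum]
      exact Finset.sum_congr rfl fun j _ => smul_comm _ _ _
    simp [this]

lemma biL_apply {d N : ℕ} (Pr : Matrix (Fin N) (Fin N) ℝ)
    (G H V : Fin N → Matrix (Fin d) (Fin d) ℝ) (i : Fin N) :
    biL Pr G H V i = (G i)ᵀ * opE Pr V i * H i := rfl

lemma quad_biL {d N : ℕ} (Pr : Matrix (Fin N) (Fin N) ℝ)
    (G H V : Fin N → Matrix (Fin d) (Fin d) ℝ) (i : Fin N) (x : Fin d → ℝ) :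
    x ⬝ᵥ (biL Pr G H V i) *ᵥ x = (G i *ᵥ x) ⬝ᵥ (opE Pr V i) *ᵥ (H i *ᵥ x) := by
  rw [biL_apply, ← Matrix.mulVec_mulVec, ← Matrix.mulVec_mulVec, dotProduct_mulVec,
    Matrix.vecMul_transpose]

lemma quad_tMM {d k : ℕ} (G H : Matrix (Fin k) (Fin d) ℝ) (M : Matrix (Fin k) (Fin k) ℝ)
    (x : Fin d → ℝ) :
    x ⬝ᵥ (Gᵀ * M * H) *ᵥ x = (G *ᵥ x) ⬝ᵥ M *ᵥ (H *ᵥ x) := by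
  rw [← Matrix.mulVec_mulVec, ← Matrix.mulVec_mulVec, dotProduct_mulVec,
    Matrix.vecMul_transpose]

lemma quad_opE {d N : ℕ} (Pr : Matrix (Fin N) (Fin N) ℝ)
    (V : Fin N → Matrix (Fin d) (Fin d) ℝ) (i : Fin N) (x : Fin d → ℝ) :
    x ⬝ᵥ (opE Pr V i) *ᵥ x = ∑ j, Pr i j * (x ⬝ᵥ V j *ᵥ x) := by
  simp [opE, Matrix.sum_mulVec, dotProduct_sum, Matrix.smul_mulVec]

/-- All quadratic forms nonnegative. -/
def Qn {d N : ℕ} (V : Fin N → Matrix (Fin d) (Fin d) ℝ) : Prop :=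
  ∀ i (x : Fin d → ℝ), 0 ≤ x ⬝ᵥ V i *ᵥ x

lemma Qn.opE {d N : ℕ} {Pr : Matrix (Fin N) (Fin N) ℝ} (hPr : ∀ i j, 0 ≤ Pr i j)
    {V : Fin N → Matrix (Fin d) (Fin d) ℝ} (hV : Qn V) : Qn (opE Pr V) := fun i x => by
  rw [quad_opE]
  exact Finset.sum_nonneg fun j _ => mul_nonneg (hPr i j) (hV j x)

lemma Qn.biL {d N : ℕ} {Pr : Matrix (Fin N) (Fin N) ℝ} (hPr : ∀ i j, 0 ≤ Pr i j)
    {V : Fin N → Matrix (Fin d) (Fin d) ℝ} (hV : Qn V) (G : Fin N → Matrix (Fin d) (Fin d) ℝ) :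
    Qn (biL Pr G G V) := fun i x => by
  rw [quad_biL]; exact (hV.opE hPr) i _

/-- Powers of `L` tend to zero pointwise. -/
def StableOp {d N : ℕ}
    (L : (Fin N → Matrix (Fin d) (Fin d) ℝ) →ₗ[ℝ] (Fin N → Matrix (Fin d) (Fin d) ℝ)) : Prop :=
  ∀ V i a b, Tendsto (fun n : ℕ => (L ^ n) V i a b) atTop (𝓝 0)

lemma StableOp.pos {d N : ℕ}
    {L : (Fin N → Matrix (Fin d) (Fin d) ℝ) →ₗ[ℝ] (Fin N → Matrix (Fin d) (Fin d) ℝ)}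
    (hL : StableOp L) (hpos : ∀ V, Qn V → Qn (L V))
    {P S : Fin N → Matrix (Fin d) (Fin d) ℝ} (hS : Qn S) (hP : P = S + L P) : Qn P := by
  have key : ∀ n : ℕ, Qn (P - (L ^ n) P) := by
    intro n
    induction n with
    | zero => intro i x; simp
    | succ n ih =>
      have h1 := hpos _ ih
      have h2 : P - (L ^ (n + 1)) P = S + L (P - (L ^ n) P) := by
        rw [pow_succ', Module.End.mul_apply, map_sub]
        nth_rw 1 [hP]
        abel
      intro i x
      rw [h2, Pi.add_apply, Matrix.add_mulVec, dotProduct_add]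
      exact add_nonneg (hS i x) (h1 i x)
  intro i x
  have hlim : Tendsto (fun n : ℕ => x ⬝ᵥ (P - (L ^ n) P) i *ᵥ x) atTop (𝓝 (x ⬝ᵥ P i *ᵥ x)) := by
    have : Tendsto (fun n : ℕ => x ⬝ᵥ (P i - (L ^ n) P i) *ᵥ x) atTop
        (𝓝 (x ⬝ᵥ (P i - 0) *ᵥ x)) := by
      simp only [dotProduct, Matrix.mulVec, Matrix.sub_apply]
      refine tendsto_finsetSum _ fun a _ => Tendsto.const_mul _ ?_
      refine tendsto_finsetSum _ fun b _ => Tendsto.mul_const _ ?_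
      exact Tendsto.const_sub _ (hL P i a b)
    simpa using this
  exact ge_of_tendsto' hlim fun n => key n i x

lemma StableOp.inj {d N : ℕ}
    {L : (Fin N → Matrix (Fin d) (Fin d) ℝ) →ₗ[ℝ] (Fin N → Matrix (Fin d) (Fin d) ℝ)}
    (hL : StableOp L) {P : Fin N → Matrix (Fin d) (Fin d) ℝ} (hP : P = L P) : P = 0 := by
  have key : ∀ n : ℕ, (L ^ n) P = P := by
    intro n
    induction n with
    | zero => simp
    | succ n ih => rw [pow_succ', Module.End.mul_apply, ih, ← hP]
  funext i
  ext a b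
  have := hL P i a b
  simp only [key] at this
  exact tendsto_nhds_unique tendsto_const_nhds this

lemma pow_entry_tendsto {n : Type*} [Fintype n] [DecidableEq n] (M : Matrix n n ℂ)
    (h : spectralRadius ℂ M < 1) (i j : n) :
    Tendsto (fun t : ℕ => (M ^ t) i j) atTop (𝓝 0) := by
  let _ : NormedRing (Matrix n n ℂ) := Matrix.linftyOpNormedRing
  let _ : NormedAlgebra ℂ (Matrix n n ℂ) := Matrix.linftyOpNormedAlgebra
  have : CompleteSpace (Matrix n n ℂ) := FiniteDimensional.complete ℂ _
  obtain ⟨r, hr1, hr2⟩ := ENNReal.lt_iff_exists_nnreal_btwn.mp h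
  have hg := spectrum.pow_nnnorm_pow_one_div_tendsto_nhds_spectralRadius M
  have hr2' : r < 1 := by exact_mod_cast hr2
  have ev : ∀ᶠ t : ℕ in atTop, ‖M ^ t‖ ≤ (r : ℝ) ^ t := by
    filter_upwards [hg.eventually (gt_mem_nhds hr1), eventually_gt_atTop 0] with t ht ht0
    have h1 := ENNReal.rpow_le_rpow ht.le (z := (t : ℝ)) (by positivity)
    rw [← ENNReal.rpow_mul, one_div, inv_mul_cancel₀ (by positivity), ENNReal.rpow_one,
      ENNReal.rpow_natCast] at h1
    have h2 : ‖M ^ t‖₊ ≤ r ^ t := by exact_mod_cast h1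
    exact_mod_cast h2
  have hz : Tendsto (fun t : ℕ => (r : ℝ) ^ t) atTop (𝓝 0) :=
    tendsto_pow_atTop_nhds_zero_of_lt_one r.2 (by exact_mod_cast hr2')
  refine squeeze_zero_norm' ?_ hz
  filter_upwards [ev] with t ht
  refine le_trans ?_ ht
  rw [Matrix.linfty_opNorm_def]
  have h1 : ‖(M ^ t) i j‖₊ ≤ ∑ j, ‖(M ^ t) i j‖₊ :=
    Finset.single_le_sum (f := fun j => ‖(M ^ t) i j‖₊) (fun _ _ => zero_le) (Finset.mem_univ j)
  have h2 : ∑ j, ‖(M ^ t) i j‖₊ ≤ Finset.univ.sup fun i => ∑ j, ‖(M ^ t) i j‖₊ :=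
    Finset.le_sup (f := fun i => ∑ j, ‖(M ^ t) i j‖₊) (Finset.mem_univ i)
  exact_mod_cast h1.trans h2

/-- vectorisation -/
def vecT {d N : ℕ} (V : Fin N → Matrix (Fin d) (Fin d) ℝ) : Fin N × Fin d × Fin d → ℝ :=
  fun p => V p.1 p.2.1 p.2.2

lemma calA_mulVec {d N : ℕ} (Pr : Matrix (Fin N) (Fin N) ℝ)
    (Γ V : Fin N → Matrix (Fin d) (Fin d) ℝ) :
    calA Pr Γ *ᵥ vecT V = vecT (biL Pr Γ Γ V) := by
  unfold calA
  rw [← Matrix.mulVec_mulVec]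
  have h1 : (Pr ⊗ₖ (1 : Matrix (Fin d × Fin d) (Fin d × Fin d) ℝ)) *ᵥ vecT V
      = vecT (opE Pr V) := by
    funext ⟨i, a, b⟩
    simp [Matrix.mulVec, dotProduct, Fintype.sum_prod_type, Matrix.one_apply, vecT, opE,
      Matrix.sum_apply, Prod.ext_iff, ite_and]
  rw [h1]
  funext ⟨i, a, b⟩
  simp only [Matrix.mulVec, dotProduct, Fintype.sum_prod_type, vecT, Matrix.reindex_apply,
    Matrix.submatrix_apply, Equiv.prodComm_symm, Equiv.prodComm_apply, Prod.swap,
    Matrix.blockDiagonal_apply, Matrix.kroneckerMap_apply, Matrix.transpose_apply, ite_mul,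
    zero_mul, biL_apply, Matrix.mul_apply, Finset.sum_mul]
  rw [Finset.sum_eq_single i (fun j _ hj => by simp [Ne.symm hj]) (by simp)]
  simp only [if_true]
  rw [Finset.sum_comm]
  refine Finset.sum_congr rfl fun x _ => Finset.sum_congr rfl fun y _ => ?_
  ring

lemma MSS.stable {d k N : ℕ} {Pr : Matrix (Fin N) (Fin N) ℝ}
    {A : Fin N → Matrix (Fin d) (Fin d) ℝ} {B : Fin N → Matrix (Fin d) (Fin k) ℝ}
    {K : Fin N → Matrix (Fin k) (Fin d) ℝ} (h : MSS Pr A B K) :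
    StableOp (biL Pr (Gam A B K) (Gam A B K)) := by
  set Γ := Gam A B K with hΓ
  have hpow : ∀ V (n : ℕ), (calA Pr Γ ^ n) *ᵥ vecT V = vecT ((biL Pr Γ Γ ^ n) V) := by
    intro V n
    induction n with
    | zero => simp
    | succ n ih =>
      rw [pow_succ', pow_succ', Module.End.mul_apply, ← calA_mulVec, ← ih, Matrix.mulVec_mulVec]
  have hent : ∀ p q, Tendsto (fun t : ℕ => (calA Pr Γ ^ t) p q) atTop (𝓝 0) := by
    intro p q
    have h1 := pow_entry_tendsto ((calA Pr Γ).map (algebraMap ℝ ℂ))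
      (by unfold MSS at h; convert h) p q
    have h2 : ∀ t : ℕ, ((calA Pr Γ).map (algebraMap ℝ ℂ) ^ t) p q
        = (((calA Pr Γ ^ t) p q : ℝ) : ℂ) := by
      intro t
      have := map_pow (algebraMap ℝ ℂ).mapMatrix (calA Pr Γ) t
      rw [RingHom.mapMatrix_apply, RingHom.mapMatrix_apply] at this
      rw [← this]; rfl
    simp only [h2] at h1
    have h3 := (Complex.continuous_re.tendsto _).comp h1
    simpa [Function.comp_def] using h3
  intro V i a b
  have h4 : ∀ n : ℕ, (biL Pr Γ Γ ^ n) V i a b = ((calA Pr Γ ^ n) *ᵥ vecT V) (i, a, b) := by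
    intro n; rw [hpow]; rfl
  simp only [h4, Matrix.mulVec, dotProduct]
  have : Tendsto (fun n : ℕ => ∑ q, (calA Pr Γ ^ n) (i, a, b) q * vecT V q) atTop
      (𝓝 (∑ q, 0 * vecT V q)) :=
    tendsto_finsetSum _ fun q _ => (hent _ q).mul_const _
  simpa using this

/-! ### Quadratic form estimates -/

lemma pol_le {n : ℕ} {M : Matrix (Fin n) (Fin n) ℝ} (hM : ∀ x : Fin n → ℝ, 0 ≤ x ⬝ᵥ M *ᵥ x)
    (a b : Fin n → ℝ) : |a ⬝ᵥ M *ᵥ b + b ⬝ᵥ M *ᵥ a| ≤ a ⬝ᵥ M *ᵥ a + b ⬝ᵥ M *ᵥ b := by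
  have h1 := hM (a + b)
  have h2 := hM (a - b)
  simp only [Matrix.mulVec_add, Matrix.mulVec_sub, dotProduct_add, add_dotProduct,
    dotProduct_sub, sub_dotProduct] at h1 h2
  rw [abs_le]; constructor <;> linarith

lemma cross0 {n : ℕ} {Z : Matrix (Fin n) (Fin n) ℝ} {p : ℝ}
    (hZ : ∀ z : Fin n → ℝ, |z ⬝ᵥ Z *ᵥ z| ≤ p * (z ⬝ᵥ z)) (u v : Fin n → ℝ) :
    |u ⬝ᵥ Z *ᵥ v + v ⬝ᵥ Z *ᵥ u| ≤ p * (u ⬝ᵥ u + v ⬝ᵥ v) := by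
  have h1 := abs_le.mp (hZ (u + v))
  have h2 := abs_le.mp (hZ (u - v))
  simp only [Matrix.mulVec_add, Matrix.mulVec_sub, dotProduct_add, add_dotProduct,
    dotProduct_sub, sub_dotProduct] at h1 h2
  obtain ⟨h1, h1'⟩ := h1
  obtain ⟨h2, h2'⟩ := h2
  rw [abs_le]; constructor <;> nlinarith

lemma cross {n : ℕ} {Z : Matrix (Fin n) (Fin n) ℝ} {p b s : ℝ} (hp : 0 ≤ p) (hb : 0 ≤ b)
    (hZ : ∀ z : Fin n → ℝ, |z ⬝ᵥ Z *ᵥ z| ≤ p * (z ⬝ᵥ z)) (u v : Fin n → ℝ)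
    (hu : u ⬝ᵥ u ≤ b ^ 2 * s) :
    |u ⬝ᵥ Z *ᵥ v + v ⬝ᵥ Z *ᵥ u| ≤ b * p * (s + v ⬝ᵥ v) := by
  rcases hb.eq_or_lt with rfl | hb
  · have : u = 0 := by
      have h0 : u ⬝ᵥ u = 0 := le_antisymm (by simpa using hu) (dot_self_nonneg u)
      exact dotProduct_self_eq_zero.mp h0
    subst this; simp
  · have h := cross0 hZ (b⁻¹ • u) v
    have h2 : (b⁻¹ • u) ⬝ᵥ (b⁻¹ • u) ≤ s := by
      simp only [smul_dotProduct, dotProduct_smul, smul_eq_mul]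
      rw [inv_mul_le_iff₀ hb, inv_mul_le_iff₀ hb]; linarith
    have h3 : u ⬝ᵥ Z *ᵥ v + v ⬝ᵥ Z *ᵥ u
        = b * ((b⁻¹ • u) ⬝ᵥ Z *ᵥ v + v ⬝ᵥ Z *ᵥ (b⁻¹ • u)) := by
      simp only [smul_dotProduct, Matrix.mulVec_smul, dotProduct_smul, smul_eq_mul]
      field_simp
    rw [h3, abs_mul, abs_of_pos hb, mul_assoc]
    refine mul_le_mul_of_nonneg_left (h.trans ?_) hb.le
    exact mul_le_mul_of_nonneg_left (by linarith) hp

lemma frob_bound {d k N : ℕ} (E : Fin N → Matrix (Fin k) (Fin d) ℝ) (hE : norm2sq E = 1)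
    (i : Fin N) (x : Fin d → ℝ) : (E i *ᵥ x) ⬝ᵥ (E i *ᵥ x) ≤ x ⬝ᵥ x := by
  have h1 : ∀ j, ((E j)ᵀ * E j).trace = ∑ a, ∑ b, (E j a b) ^ 2 := by
    intro j
    simp only [Matrix.trace, Matrix.diag, Matrix.mul_apply, Matrix.transpose_apply]
    rw [Finset.sum_comm]
    simp [sq]
  have h2 : ∑ a, ∑ b, (E i a b) ^ 2 ≤ 1 := by
    rw [← hE]; unfold norm2sq; simp only [h1]
    exact Finset.single_le_sum (f := fun j => ∑ a, ∑ b, (E j a b) ^ 2)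
      (fun j _ => Finset.sum_nonneg fun a _ => Finset.sum_nonneg fun b _ => sq_nonneg _)
      (Finset.mem_univ i)
  calc (E i *ᵥ x) ⬝ᵥ (E i *ᵥ x) = ∑ a, (∑ b, E i a b * x b) ^ 2 := by
        simp [dotProduct, Matrix.mulVec, sq]
    _ ≤ ∑ a, (∑ b, (E i a b) ^ 2) * (∑ b, x b ^ 2) :=
        Finset.sum_le_sum fun a _ => Finset.sum_mul_sq_le_sq_mul_sq _ _ _
    _ = (∑ a, ∑ b, (E i a b) ^ 2) * (x ⬝ᵥ x) := by
        rw [← Finset.sum_mul]; simp [dotProduct, sq]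
    _ ≤ _ := mul_le_of_le_one_left (dot_self_nonneg x) h2

lemma StableOp.exists_sol {d N : ℕ}
    {L : (Fin N → Matrix (Fin d) (Fin d) ℝ) →ₗ[ℝ] (Fin N → Matrix (Fin d) (Fin d) ℝ)}
    (hL : StableOp L) (S : Fin N → Matrix (Fin d) (Fin d) ℝ) : ∃ P, P = S + L P := by
  have hinj : Function.Injective ((1 : Module.End ℝ (Fin N → Matrix (Fin d) (Fin d) ℝ)) - L) := by
    rw [← LinearMap.ker_eq_bot, LinearMap.ker_eq_bot']
    intro P hP
    refine hL.inj ?_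
    simpa [sub_eq_zero] using hP
  obtain ⟨P, hP⟩ := LinearMap.injective_iff_surjective.mp hinj S
  refine ⟨P, ?_⟩
  rw [← hP]; simp

/-- The linear functional defining the cost. -/
noncomputable def ell {d N : ℕ} (piv : Fin N → ℝ) (Sg : Matrix (Fin d) (Fin d) ℝ) :
    (Fin N → Matrix (Fin d) (Fin d) ℝ) →ₗ[ℝ] ℝ where
  toFun V := ∑ i, piv i * (V i * Sg).trace
  map_add' V W := by
    simp [Matrix.add_mul, mul_add, Finset.sum_add_distrib]
  map_smul' c V := by
    simp only [Pi.smul_apply, Matrix.smul_mul, Matrix.trace_smul, smul_eq_mul, RingHom.id_apply,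
      Finset.mul_sum]
    exact Finset.sum_congr rfl fun j _ => by ring

lemma ell_nonneg {d N : ℕ} {piv : Fin N → ℝ} {Sg : Matrix (Fin d) (Fin d) ℝ}
    (hpiv : ∀ i, 0 < piv i) (hSg : Sg.PosDef) {V : Fin N → Matrix (Fin d) (Fin d) ℝ}
    (hV : Qn V) : 0 ≤ ell piv Sg V := by
  change 0 ≤ ∑ i, piv i * (V i * Sg).trace
  exact Finset.sum_nonneg fun i _ =>
    mul_nonneg (hpiv i).le (trace_mul_nonneg _ _ (hV i) hSg.posSemidef)

lemma quad_le_ell {d N : ℕ} (hd : 0 < d) {piv : Fin N → ℝ} {Sg : Matrix (Fin d) (Fin d) ℝ}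
    (hpiv : ∀ i, 0 < piv i) (hSg : Sg.PosDef) {V : Fin N → Matrix (Fin d) (Fin d) ℝ}
    (hV : Qn V) (i : Fin N) (x : Fin d → ℝ) :
    mu piv Sg * (x ⬝ᵥ V i *ᵥ x) ≤ ell piv Sg V * (x ⬝ᵥ x) := by
  have h1 : piv i * (V i * Sg).trace ≤ ell piv Sg V :=
    Finset.single_le_sum (f := fun i => piv i * (V i * Sg).trace)
      (fun i _ => mul_nonneg (hpiv i).le (trace_mul_nonneg _ _ (hV i) hSg.posSemidef))
      (Finset.mem_univ i)
  have hsym : Sgᵀ = Sg := (by simpa using hSg.1 : Sg.IsSymm)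
  have hpsd : (((x ⬝ᵥ x) * piv i) • Sg - mu piv Sg • Matrix.vecMulVec x x).PosSemidef := by
    refine Matrix.PosSemidef.of_dotProduct_mulVec_nonneg ?_ ?_
    · change _ᴴ = _
      simp [Matrix.conjTranspose_eq_transpose_of_trivial, hsym, Matrix.transpose_vecMulVec]
    · intro y
      simp only [star_trivial, Matrix.sub_mulVec, Matrix.smul_mulVec, dotProduct_sub,
        dotProduct_smul, smul_eq_mul, Matrix.vecMulVec_mulVec]
      have h2 := mu_quad piv hd Sg hSg hpiv i y
      have hcs : (x ⬝ᵥ y) ^ 2 ≤ (x ⬝ᵥ x) * (y ⬝ᵥ y) := by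
        have := Finset.sum_mul_sq_le_sq_mul_sq Finset.univ x y
        simpa [dotProduct, sq] using this
      have hmu : 0 ≤ mu piv Sg := by
        have : 0 < N := lt_of_le_of_lt (Nat.zero_le _) i.2
        exact (mu_pos hd this piv hpiv Sg hSg).le
      have h3 := mul_le_mul_of_nonneg_left hcs hmu
      have h4 := mul_le_mul_of_nonneg_left h2 (dot_self_nonneg x)
      have h5 : y ⬝ᵥ x = x ⬝ᵥ y := dotProduct_comm _ _
      simp [h5]
      nlinarith
  have h3 := trace_mul_nonneg _ _ (hV i) hpsd
  rw [Matrix.mul_sub, Matrix.trace_sub, Matrix.mul_smul, Matrix.mul_smul, Matrix.trace_smul,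
    Matrix.trace_smul, Matrix.mul_vecMulVec, Matrix.trace_vecMulVec, dotProduct_comm] at h3
  simp only [smul_eq_mul] at h3
  rw [dotProduct_comm (V i *ᵥ x)] at h3
  have h4 := mul_le_mul_of_nonneg_left h1 (dot_self_nonneg x)
  nlinarith

lemma hess_bound {d k N : ℕ} (hd : 0 < d) (hN : 0 < N)
    (B : Fin N → Matrix (Fin d) (Fin k) ℝ)
    (Pr : Matrix (Fin N) (Fin N) ℝ)
    (hPr : ∀ i j, 0 ≤ Pr i j) (hPrSum : ∀ i, ∑ j, Pr i j = 1)
    (piv : Fin N → ℝ) (hpiv : ∀ i, 0 < piv i)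
    (Sg : Matrix (Fin d) (Fin d) ℝ) (hSg : Sg.PosDef)
    (Q : Fin N → Matrix (Fin d) (Fin d) ℝ) (hQ : ∀ i, (Q i).PosDef)
    (R : Fin N → Matrix (Fin k) (Fin k) ℝ) (hR : ∀ i, (R i).PosDef)
    (α : ℝ) (K E : Fin N → Matrix (Fin k) (Fin d) ℝ) (hE : norm2sq E = 1)
    (Γ D P P1 P2 : Fin N → Matrix (Fin d) (Fin d) ℝ)
    (hD : ∀ i, D i = B i * E i)
    (hst : StableOp (biL Pr Γ Γ))
    (hP : P = (fun i => Q i + (K i)ᵀ * R i * K i) + biL Pr Γ Γ P)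
    (hP1 : P1 = ((fun i => (E i)ᵀ * R i * K i + (K i)ᵀ * R i * E i)
      - (biL Pr D Γ P + biL Pr Γ D P)) + biL Pr Γ Γ P1)
    (hP2 : P2 = ((2 : ℝ) • (fun i => (E i)ᵀ * R i * E i) + (2 : ℝ) • biL Pr D D P
      - (2 : ℝ) • (biL Pr D Γ P1 + biL Pr Γ D P1)) + biL Pr Γ Γ P2)
    (hα : ell piv Sg P ≤ α) : |ell piv Sg P2| ≤ Lsm B R Q piv Sg α := by
  have hmono : ∀ V, Qn V → Qn (biL Pr Γ Γ V) := fun V hV => hV.biL hPr Γ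
  have hmu := mu_pos hd hN piv hpiv Sg hSg
  have hlam := lamMin_pos hd hN Q hQ
  have hQq : ∀ i (x : Fin d → ℝ), lamMin Q * (x ⬝ᵥ x) ≤ x ⬝ᵥ Q i *ᵥ x := fun i x =>
    (mul_le_mul_of_nonneg_right (lamMin_le Q i) (dot_self_nonneg x)).trans
      (sigmaMin_quad (hQ i) x)
  have hRn : ∀ i (x : Fin k → ℝ), 0 ≤ x ⬝ᵥ R i *ᵥ x := fun i x => by
    simpa using (hR i).posSemidef.dotProduct_mulVec_nonneg x
  have hS0 : ∀ i (x : Fin d → ℝ), x ⬝ᵥ (Q i + (K i)ᵀ * R i * K i) *ᵥ x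
      = x ⬝ᵥ Q i *ᵥ x + (K i *ᵥ x) ⬝ᵥ R i *ᵥ (K i *ᵥ x) := fun i x => by
    rw [Matrix.add_mulVec, dotProduct_add, quad_tMM]
  have hQnn : ∀ i (x : Fin d → ℝ), 0 ≤ x ⬝ᵥ Q i *ᵥ x := fun i x =>
    (mul_nonneg hlam.le (dot_self_nonneg x)).trans (hQq i x)
  have hPn : Qn P := hst.pos hmono (fun i x => by
    rw [hS0]; exact add_nonneg (hQnn i x) (hRn i _)) hP
  set m := α / mu piv Sg with hm
  set b := maxNorm B with hb
  set r := maxNorm R with hr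
  set Λ := lamMin Q with hΛ
  set ξ := xi B R Q piv Sg α with hξ
  have hb0 : 0 ≤ b := maxNorm_nonneg B
  have hr0 : 0 ≤ r := maxNorm_nonneg R
  have hα0 : 0 ≤ α := (ell_nonneg hpiv hSg hPn).trans hα
  have hm0 : 0 ≤ m := div_nonneg hα0 hmu.le
  -- bound on P
  have hPm : ∀ i (x : Fin d → ℝ), x ⬝ᵥ P i *ᵥ x ≤ m * (x ⬝ᵥ x) := fun i x => by
    have h1 := quad_le_ell hd hpiv hSg hPn i x
    have h2 := mul_le_mul_of_nonneg_right hα (dot_self_nonneg x)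
    rw [hm, div_mul_eq_mul_div, le_div_iff₀ hmu]
    linarith
  have hEPm : ∀ i (x : Fin d → ℝ), x ⬝ᵥ opE Pr P i *ᵥ x ≤ m * (x ⬝ᵥ x) := fun i x => by
    rw [quad_opE]
    calc _ ≤ ∑ j, Pr i j * (m * (x ⬝ᵥ x)) :=
          Finset.sum_le_sum fun j _ => mul_le_mul_of_nonneg_left (hPm j x) (hPr i j)
      _ = _ := by rw [← Finset.sum_mul, hPrSum, one_mul]
  have hEPn : Qn (opE Pr P) := hPn.opE hPr
  have hEx := frob_bound E hE
  have hDx : ∀ i (x : Fin d → ℝ), (D i *ᵥ x) ⬝ᵥ (D i *ᵥ x) ≤ b ^ 2 * (x ⬝ᵥ x) := fun i x => by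
    rw [hD, ← Matrix.mulVec_mulVec]
    refine (specNorm_sq (B i) _).trans ?_
    exact mul_le_mul (pow_le_pow_left₀ (specNorm_nonneg _) (le_maxNorm B i) 2) (hEx i x)
      (dot_self_nonneg _) (by positivity)
  have hERE : ∀ i (x : Fin d → ℝ), (E i *ᵥ x) ⬝ᵥ R i *ᵥ (E i *ᵥ x) ≤ r * (x ⬝ᵥ x) := fun i x =>
    (quad_le_specNorm (R i) _).trans
      (mul_le_mul (le_maxNorm R i) (hEx i x) (dot_self_nonneg _) hr0)
  have hDPD : ∀ i (x : Fin d → ℝ), (D i *ᵥ x) ⬝ᵥ opE Pr P i *ᵥ (D i *ᵥ x)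
      ≤ m * b ^ 2 * (x ⬝ᵥ x) := fun i x => by
    refine (hEPm i _).trans ?_
    rw [mul_assoc]
    exact mul_le_mul_of_nonneg_left (hDx i x) hm0
  have hPq : ∀ i (x : Fin d → ℝ), x ⬝ᵥ P i *ᵥ x = x ⬝ᵥ Q i *ᵥ x
      + (K i *ᵥ x) ⬝ᵥ R i *ᵥ (K i *ᵥ x)
      + (Γ i *ᵥ x) ⬝ᵥ opE Pr P i *ᵥ (Γ i *ᵥ x) := fun i x => by
    have : P i = (Q i + (K i)ᵀ * R i * K i) + biL Pr Γ Γ P i := congrFun hP i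
    rw [this, Matrix.add_mulVec, dotProduct_add, hS0, quad_biL]
  -- bound on the source of P1
  set S1 := ((fun i => (E i)ᵀ * R i * K i + (K i)ᵀ * R i * E i)
      - (biL Pr D Γ P + biL Pr Γ D P)) with hS1
  have hS1q : ∀ i (x : Fin d → ℝ), x ⬝ᵥ S1 i *ᵥ x =
      ((E i *ᵥ x) ⬝ᵥ R i *ᵥ (K i *ᵥ x) + (K i *ᵥ x) ⬝ᵥ R i *ᵥ (E i *ᵥ x))
      - ((D i *ᵥ x) ⬝ᵥ opE Pr P i *ᵥ (Γ i *ᵥ x)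
        + (Γ i *ᵥ x) ⬝ᵥ opE Pr P i *ᵥ (D i *ᵥ x)) := fun i x => by
    rw [hS1]
    simp only [Pi.sub_apply, Pi.add_apply, Matrix.sub_mulVec, Matrix.add_mulVec, dotProduct_sub,
      dotProduct_add, quad_tMM, quad_biL]
  have hxiQ : ∀ i (x : Fin d → ℝ), |x ⬝ᵥ S1 i *ᵥ x| ≤ ξ * (x ⬝ᵥ Q i *ᵥ x) := fun i x => by
    have h1 := pol_le (hRn i) (E i *ᵥ x) (K i *ᵥ x)
    have h2 := pol_le (hEPn i) (D i *ᵥ x) (Γ i *ᵥ x)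
    have h3 : |x ⬝ᵥ S1 i *ᵥ x| ≤ (m + m * b ^ 2 + r) * (x ⬝ᵥ x) - x ⬝ᵥ Q i *ᵥ x := by
      rw [hS1q]
      refine (abs_sub _ _).trans ?_
      have := hPm i x
      rw [hPq] at this
      have := hERE i x
      have := hDPD i x
      linarith
    have h4 : ξ * (x ⬝ᵥ Q i *ᵥ x) = (m + m * b ^ 2 + r) * ((x ⬝ᵥ Q i *ᵥ x) / Λ)
        - x ⬝ᵥ Q i *ᵥ x := by
      rw [hξ, hm]; unfold xi; rw [← hΛ, ← hb, ← hr]; field_simp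
    rw [h4]
    refine h3.trans ?_
    have h5 : x ⬝ᵥ x ≤ (x ⬝ᵥ Q i *ᵥ x) / Λ := by
      rw [le_div_iff₀ hlam]; linarith [hQq i x]
    have h6 := mul_le_mul_of_nonneg_left h5 (by positivity : 0 ≤ m + m * b ^ 2 + r)
    linarith
  have hξ0 : 0 ≤ ξ := by
    let x : Fin d → ℝ := fun _ => 1
    have hx : 0 < x ⬝ᵥ x := by simp [x, dotProduct, hd]
    have h1 := (abs_nonneg _).trans (hxiQ ⟨0, hN⟩ x)
    have h2 : 0 < x ⬝ᵥ Q ⟨0, hN⟩ *ᵥ x := lt_of_lt_of_le (mul_pos hlam hx) (hQq _ x)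
    exact nonneg_of_mul_nonneg_left h1 h2
  have hS1S0 : ∀ i (x : Fin d → ℝ), |x ⬝ᵥ S1 i *ᵥ x|
      ≤ ξ * (x ⬝ᵥ (Q i + (K i)ᵀ * R i * K i) *ᵥ x) := fun i x => by
    rw [hS0]
    have := mul_nonneg hξ0 (hRn i (K i *ᵥ x))
    linarith [hxiQ i x]
  set S0 : Fin N → Matrix (Fin d) (Fin d) ℝ := (fun i => Q i + (K i)ᵀ * R i * K i) with hS0def
  have hup : Qn (ξ • P - P1) := by
    refine hst.pos hmono (S := ξ • S0 - S1) ?_ ?_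
    · intro i x
      have := (abs_le.mp (hS1S0 i x)).2
      simp only [Pi.sub_apply, Pi.smul_apply, Matrix.sub_mulVec, Matrix.smul_mulVec,
        dotProduct_sub, dotProduct_smul, smul_eq_mul, hS0def]
      linarith
    · rw [map_sub, map_smul]
      nth_rw 1 [hP, hP1]
      rw [smul_add]; abel
  have hlo : Qn (ξ • P + P1) := by
    refine hst.pos hmono (S := ξ • S0 + S1) ?_ ?_
    · intro i x
      have := (abs_le.mp (hS1S0 i x)).1
      simp only [Pi.add_apply, Pi.smul_apply, Matrix.add_mulVec, Matrix.smul_mulVec,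
        dotProduct_add, dotProduct_smul, smul_eq_mul, hS0def] at this ⊢
      linarith
    · rw [map_add, map_smul]
      nth_rw 1 [hP, hP1]
      rw [smul_add]; abel
  have hP1m : ∀ i (x : Fin d → ℝ), |x ⬝ᵥ P1 i *ᵥ x| ≤ ξ * m * (x ⬝ᵥ x) := fun i x => by
    have h1 := hup i x
    have h2 := hlo i x
    simp only [Pi.sub_apply, Pi.add_apply, Pi.smul_apply, Matrix.sub_mulVec, Matrix.add_mulVec,
      Matrix.smul_mulVec, dotProduct_sub, dotProduct_add, dotProduct_smul, smul_eq_mul] at h1 h2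
    have h3 := mul_le_mul_of_nonneg_left (hPm i x) hξ0
    rw [abs_le]; constructor <;> linarith
  have hEP1 : ∀ i (x : Fin d → ℝ), |x ⬝ᵥ opE Pr P1 i *ᵥ x| ≤ ξ * m * (x ⬝ᵥ x) := fun i x => by
    rw [quad_opE]
    refine (Finset.abs_sum_le_sum_abs _ _).trans ?_
    calc _ ≤ ∑ j, Pr i j * (ξ * m * (x ⬝ᵥ x)) := Finset.sum_le_sum fun j _ => by
            rw [abs_mul, abs_of_nonneg (hPr i j)]
            exact mul_le_mul_of_nonneg_left (hP1m j x) (hPr i j)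
      _ = _ := by rw [← Finset.sum_mul, hPrSum, one_mul]
  have hpm : 0 ≤ ξ * m := mul_nonneg hξ0 hm0
  -- the comparison solution
  let I : Fin N → Matrix (Fin d) (Fin d) ℝ := fun _ => 1
  have hIq : ∀ i (x : Fin d → ℝ), x ⬝ᵥ I i *ᵥ x = x ⬝ᵥ x := fun i x => by simp [I]
  have hIn : Qn I := fun i x => by rw [hIq i]; exact dot_self_nonneg x
  have hEI : opE Pr I = I := by
    funext i; simp only [opE, I]; rw [← Finset.sum_smul, hPrSum, one_smul]
  have hLI : ∀ i (x : Fin d → ℝ), x ⬝ᵥ biL Pr Γ Γ I i *ᵥ x = (Γ i *ᵥ x) ⬝ᵥ (Γ i *ᵥ x) :=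
    fun i x => by rw [quad_biL, hEI, hIq i]
  obtain ⟨J, hJ⟩ := hst.exists_sol I
  have hJP : Λ * ell piv Sg J ≤ α := by
    have h1 : Qn (P - Λ • J) := by
      refine hst.pos hmono (S := S0 - Λ • I) ?_ ?_
      · intro i x
        simp only [Pi.sub_apply, Pi.smul_apply, Matrix.sub_mulVec, Matrix.smul_mulVec,
          dotProduct_sub, dotProduct_smul, smul_eq_mul, hIq]
        have : x ⬝ᵥ S0 i *ᵥ x = _ := hS0 i x
        linarith [hQq i x, hRn i (K i *ᵥ x)]
      · rw [map_sub, map_smul]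
        nth_rw 1 [hP, hJ]
        rw [smul_add]; abel
    have h2 := ell_nonneg hpiv hSg h1
    rw [map_sub, map_smul, smul_eq_mul] at h2
    linarith
  have hJn : Qn J := hst.pos hmono hIn hJ
  set a := 2 * (r + m * b ^ 2) with ha
  set β := 2 * (b * (ξ * m)) with hβ
  have hβ0 : 0 ≤ β := by positivity
  set S2 := ((2 : ℝ) • (fun i => (E i)ᵀ * R i * E i) + (2 : ℝ) • biL Pr D D P
      - (2 : ℝ) • (biL Pr D Γ P1 + biL Pr Γ D P1)) with hS2
  have hS2q : ∀ i (x : Fin d → ℝ), |x ⬝ᵥ S2 i *ᵥ x|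
      ≤ a * (x ⬝ᵥ x) + β * (x ⬝ᵥ x + (Γ i *ᵥ x) ⬝ᵥ (Γ i *ᵥ x)) := fun i x => by
    have h1 : x ⬝ᵥ S2 i *ᵥ x = 2 * ((E i *ᵥ x) ⬝ᵥ R i *ᵥ (E i *ᵥ x))
        + 2 * ((D i *ᵥ x) ⬝ᵥ opE Pr P i *ᵥ (D i *ᵥ x))
        - 2 * ((D i *ᵥ x) ⬝ᵥ opE Pr P1 i *ᵥ (Γ i *ᵥ x)
          + (Γ i *ᵥ x) ⬝ᵥ opE Pr P1 i *ᵥ (D i *ᵥ x)) := by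
      rw [hS2]
      simp only [Pi.sub_apply, Pi.add_apply, Pi.smul_apply, Matrix.sub_mulVec, Matrix.add_mulVec,
        Matrix.smul_mulVec, dotProduct_sub, dotProduct_add, dotProduct_smul, smul_eq_mul,
        quad_tMM, quad_biL]
    have h2 := abs_le.mp (cross hpm hb0 (hEP1 i) (D i *ᵥ x) (Γ i *ᵥ x) (hDx i x))
    have h3 := hERE i x
    have h4 := hDPD i x
    have h5 := hRn i (E i *ᵥ x)
    have h6 := hEPn i (D i *ᵥ x)
    obtain ⟨h2, h2'⟩ := h2
    rw [h1, ha, hβ, abs_le]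
    constructor <;> linarith
  let Z := (a + 2 * β) • J - β • I
  have hZ : Z = (a • I + β • (I + biL Pr Γ Γ I)) + biL Pr Γ Γ Z := by
    simp only [Z, map_sub, map_smul]
    nth_rw 1 [hJ]
    module
  have hZq : ∀ i (x : Fin d → ℝ), x ⬝ᵥ (a • I + β • (I + biL Pr Γ Γ I)) i *ᵥ x
      = a * (x ⬝ᵥ x) + β * (x ⬝ᵥ x + (Γ i *ᵥ x) ⬝ᵥ (Γ i *ᵥ x)) := fun i x => by
    simp only [Pi.add_apply, Pi.smul_apply, Matrix.add_mulVec,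
      Matrix.smul_mulVec, dotProduct_add, dotProduct_smul, smul_eq_mul, hIq, hLI]
  have hZ1 : Qn (Z - P2) := by
    refine hst.pos hmono (S := (a • I + β • (I + biL Pr Γ Γ I)) - S2) ?_ ?_
    · intro i x
      rw [Pi.sub_apply, Matrix.sub_mulVec, dotProduct_sub, hZq]
      linarith [(abs_le.mp (hS2q i x)).2]
    · rw [map_sub]
      nth_rw 1 [hZ, hP2]
      abel
  have hZ2 : Qn (Z + P2) := by
    refine hst.pos hmono (S := (a • I + β • (I + biL Pr Γ Γ I)) + S2) ?_ ?_
    · intro i x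
      rw [Pi.add_apply, Matrix.add_mulVec, dotProduct_add, hZq]
      linarith [(abs_le.mp (hS2q i x)).1]
    · rw [map_add]
      nth_rw 1 [hZ, hP2]
      abel
  have e1 := ell_nonneg hpiv hSg hZ1
  have e2 := ell_nonneg hpiv hSg hZ2
  have e3 := ell_nonneg hpiv hSg hIn
  have e4 : ell piv Sg J ≤ α / Λ := by rw [le_div_iff₀ hlam]; linarith
  rw [map_sub] at e1
  rw [map_add] at e2
  have e5 : ell piv Sg Z ≤ (a + 2 * β) * (α / Λ) := by
    simp only [Z, map_sub, map_smul, smul_eq_mul]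
    have h1 := mul_le_mul_of_nonneg_left e4 (by positivity : 0 ≤ a + 2 * β)
    have h2 := mul_nonneg hβ0 e3
    linarith
  have e6 : (a + 2 * β) * (α / Λ) = Lsm B R Q piv Sg α := by
    unfold Lsm
    rw [← hΛ, ← hb, ← hr, ← hξ, ha, hβ, hm]
    by_cases hb' : b = 0
    · rw [hb']; ring
    · field_simp; ring
  rw [← e6, abs_le]
  constructor <;> linarith

attribute [local instance] Matrix.normedAddCommGroup Matrix.normedSpace

/-! ### Smoothness of the cost -/

lemma contDiff_matrix {X : Type*} [NormedAddCommGroup X] [NormedSpace ℝ X] {a b : ℕ}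
    {f : X → Matrix (Fin a) (Fin b) ℝ} (h : ∀ i j, ContDiff ℝ 2 fun x => f x i j) :
    ContDiff ℝ 2 f :=
  contDiff_pi.2 fun i => contDiff_pi.2 fun j => h i j

lemma contDiff_entry {X : Type*} [NormedAddCommGroup X] [NormedSpace ℝ X] {a b : ℕ}
    {f : X → Matrix (Fin a) (Fin b) ℝ} (h : ContDiff ℝ 2 f) (i : Fin a) (j : Fin b) :
    ContDiff ℝ 2 fun x => f x i j :=
  contDiff_pi.1 (contDiff_pi.1 h i) j

lemma contDiff_matMul {X : Type*} [NormedAddCommGroup X] [NormedSpace ℝ X] {a b c : ℕ}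
    {f : X → Matrix (Fin a) (Fin b) ℝ} {g : X → Matrix (Fin b) (Fin c) ℝ}
    (hf : ContDiff ℝ 2 f) (hg : ContDiff ℝ 2 g) : ContDiff ℝ 2 fun x => f x * g x := by
  refine contDiff_matrix fun i j => ?_
  simp only [Matrix.mul_apply]
  exact ContDiff.sum fun l _ => (contDiff_entry hf i l).mul (contDiff_entry hg l j)

lemma contDiff_matTranspose {X : Type*} [NormedAddCommGroup X] [NormedSpace ℝ X] {a b : ℕ}
    {f : X → Matrix (Fin a) (Fin b) ℝ}
    (hf : ContDiff ℝ 2 f) : ContDiff ℝ 2 fun x => (f x)ᵀ :=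
  contDiff_matrix fun i j => contDiff_entry hf j i

/-- Continuous endomorphisms of a normed space. -/
abbrev CL (W : Type*) [NormedAddCommGroup W] [NormedSpace ℝ W] := W →L[ℝ] W

/-- The Lyapunov operator as a continuous linear map. -/
noncomputable def Lc {d k N : ℕ} (Pr : Matrix (Fin N) (Fin N) ℝ)
    (A : Fin N → Matrix (Fin d) (Fin d) ℝ) (B : Fin N → Matrix (Fin d) (Fin k) ℝ)
    (K : Fin N → Matrix (Fin k) (Fin d) ℝ) :
    CL (Fin N → Matrix (Fin d) (Fin d) ℝ) :=
  LinearMap.toContinuousLinearMap (biL Pr (Gam A B K) (Gam A B K))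

/-- The source term of the Lyapunov equation. -/
noncomputable def Src {d k N : ℕ}
    (Q : Fin N → Matrix (Fin d) (Fin d) ℝ) (R : Fin N → Matrix (Fin k) (Fin k) ℝ)
    (K : Fin N → Matrix (Fin k) (Fin d) ℝ) : Fin N → Matrix (Fin d) (Fin d) ℝ :=
  fun i => Q i + (K i)ᵀ * R i * K i

lemma contDiff_K {d k N : ℕ} (i : Fin N) :
    ContDiff ℝ 2 fun K : Fin N → Matrix (Fin k) (Fin d) ℝ => K i :=
  contDiff_apply ℝ _ i

lemma contDiff_Gam {d k N : ℕ}
    (A : Fin N → Matrix (Fin d) (Fin d) ℝ) (B : Fin N → Matrix (Fin d) (Fin k) ℝ) (i : Fin N) :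
    ContDiff ℝ 2 fun K : Fin N → Matrix (Fin k) (Fin d) ℝ => Gam A B K i :=
  contDiff_const.sub (contDiff_matMul contDiff_const (contDiff_K i))

lemma contDiff_Src {d k N : ℕ}
    (Q : Fin N → Matrix (Fin d) (Fin d) ℝ) (R : Fin N → Matrix (Fin k) (Fin k) ℝ) :
    ContDiff ℝ 2 (Src Q R) :=
  contDiff_pi.2 fun i => contDiff_const.add
    (contDiff_matMul (contDiff_matMul (contDiff_matTranspose (contDiff_K i)) contDiff_const)
      (contDiff_K i))

lemma contDiff_Lc {d k N : ℕ} (Pr : Matrix (Fin N) (Fin N) ℝ)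
    (A : Fin N → Matrix (Fin d) (Fin d) ℝ) (B : Fin N → Matrix (Fin d) (Fin k) ℝ) :
    ContDiff ℝ 2 (Lc Pr A B) := by
  refine contDiff_clm_apply_iff.2 fun V => contDiff_pi.2 fun i => ?_
  exact contDiff_matMul (contDiff_matMul (contDiff_matTranspose (contDiff_Gam A B i))
    contDiff_const) (contDiff_Gam A B i)

lemma isLyap_iff {d k N : ℕ} {Pr : Matrix (Fin N) (Fin N) ℝ}
    {A : Fin N → Matrix (Fin d) (Fin d) ℝ} {B : Fin N → Matrix (Fin d) (Fin k) ℝ}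
    {Q : Fin N → Matrix (Fin d) (Fin d) ℝ} {R : Fin N → Matrix (Fin k) (Fin k) ℝ}
    {K : Fin N → Matrix (Fin k) (Fin d) ℝ} {P : Fin N → Matrix (Fin d) (Fin d) ℝ} :
    IsLyap Pr A B Q R K P ↔ P = Src Q R K + biL Pr (Gam A B K) (Gam A B K) P :=
  funext_iff.symm

lemma isLyap_iff' {d k N : ℕ} {Pr : Matrix (Fin N) (Fin N) ℝ}
    {A : Fin N → Matrix (Fin d) (Fin d) ℝ} {B : Fin N → Matrix (Fin d) (Fin k) ℝ}
    {Q : Fin N → Matrix (Fin d) (Fin d) ℝ} {R : Fin N → Matrix (Fin k) (Fin k) ℝ}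
    {K : Fin N → Matrix (Fin k) (Fin d) ℝ} {P : Fin N → Matrix (Fin d) (Fin d) ℝ} :
    IsLyap Pr A B Q R K P ↔ (1 - Lc Pr A B K) P = Src Q R K := by
  rw [isLyap_iff]
  change _ ↔ P - biL Pr (Gam A B K) (Gam A B K) P = Src Q R K
  rw [sub_eq_iff_eq_add]

lemma PK_of_isUnit {d k N : ℕ} {Pr : Matrix (Fin N) (Fin N) ℝ}
    {A : Fin N → Matrix (Fin d) (Fin d) ℝ} {B : Fin N → Matrix (Fin d) (Fin k) ℝ}
    (Q : Fin N → Matrix (Fin d) (Fin d) ℝ) (R : Fin N → Matrix (Fin k) (Fin k) ℝ)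
    {K : Fin N → Matrix (Fin k) (Fin d) ℝ} (hu : IsUnit (1 - Lc Pr A B K)) :
    PK Pr A B Q R K = Ring.inverse (1 - Lc Pr A B K) (Src Q R K) ∧
      IsLyap Pr A B Q R K (PK Pr A B Q R K) := by
  have hex : ∃ P, IsLyap Pr A B Q R K P := by
    refine ⟨Ring.inverse (1 - Lc Pr A B K) (Src Q R K), isLyap_iff'.2 ?_⟩
    rw [← mul_apply_eq_comp, Ring.mul_inverse_cancel _ hu]; rfl
  have h2 : IsLyap Pr A B Q R K (PK Pr A B Q R K) := by
    unfold PK; rw [dif_pos hex]; exact hex.choose_spec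
  refine ⟨?_, h2⟩
  rw [← isLyap_iff'.1 h2, ← mul_apply_eq_comp, Ring.inverse_mul_cancel _ hu]; rfl

lemma StableOp.isUnit {d k N : ℕ} {Pr : Matrix (Fin N) (Fin N) ℝ}
    {A : Fin N → Matrix (Fin d) (Fin d) ℝ} {B : Fin N → Matrix (Fin d) (Fin k) ℝ}
    {K : Fin N → Matrix (Fin k) (Fin d) ℝ}
    (hL : StableOp (biL Pr (Gam A B K) (Gam A B K))) : IsUnit (1 - Lc Pr A B K) := by
  have hinj : Function.Injective ((1 : Module.End ℝ (Fin N → Matrix (Fin d) (Fin d) ℝ))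
      - biL Pr (Gam A B K) (Gam A B K)) := by
    rw [← LinearMap.ker_eq_bot, LinearMap.ker_eq_bot']
    intro P hP
    refine hL.inj ?_
    simpa [sub_eq_zero] using hP
  have h1 := (LinearMap.isUnit_iff_ker_eq_bot _).2 (LinearMap.ker_eq_bot.2 hinj)
  obtain ⟨u, hu⟩ := h1
  have e1 : ∀ x, (1 - Lc Pr A B K) x = u.1 x := fun x => by rw [hu]; rfl
  refine ⟨⟨1 - Lc Pr A B K, LinearMap.toContinuousLinearMap u⁻¹.1, ?_, ?_⟩, rfl⟩
  · ext1 x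
    rw [mul_apply_eq_comp, e1]
    change (u.1 * u⁻¹.1) x = x
    rw [u.mul_inv]; rfl
  · ext1 x
    rw [mul_apply_eq_comp, e1]
    change (u⁻¹.1 * u.1) x = x
    rw [u.inv_mul]; rfl

lemma PK_smooth {d k N : ℕ} {Pr : Matrix (Fin N) (Fin N) ℝ}
    {A : Fin N → Matrix (Fin d) (Fin d) ℝ} {B : Fin N → Matrix (Fin d) (Fin k) ℝ}
    (Q : Fin N → Matrix (Fin d) (Fin d) ℝ) (R : Fin N → Matrix (Fin k) (Fin k) ℝ)
    {K : Fin N → Matrix (Fin k) (Fin d) ℝ} (hK : MSS Pr A B K) :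
    ContDiffAt ℝ 2 (PK Pr A B Q R) K ∧
      ∀ᶠ K' in 𝓝 K, IsLyap Pr A B Q R K' (PK Pr A B Q R K') := by
  have hu := hK.stable.isUnit
  have hc : ContDiff ℝ 2 fun K => 1 - Lc Pr A B K := contDiff_const.sub (contDiff_Lc Pr A B)
  have hev : ∀ᶠ K' in 𝓝 K, IsUnit (1 - Lc Pr A B K') := by
    have := hc.continuous.continuousAt (x := K)
    exact this.eventually (Units.isOpen.mem_nhds hu)
  refine ⟨?_, hev.mono fun K' h => (PK_of_isUnit Q R h).2⟩
  have h1 : ContDiffAt ℝ 2 (fun K => Ring.inverse (1 - Lc Pr A B K) (Src Q R K)) K := by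
    obtain ⟨u, huu⟩ := hu
    have h2 := contDiffAt_ringInverse ℝ (n := 2) u
    rw [huu] at h2
    exact (h2.comp K hc.contDiffAt).clm_apply (contDiff_Src Q R).contDiffAt
  exact h1.congr_of_eventuallyEq (hev.mono fun K' h => (PK_of_isUnit Q R h).1)

lemma hasDerivAt_deriv_aux {W : Type*} [NormedAddCommGroup W] [NormedSpace ℝ W] {P : ℝ → W} {s : ℝ}
    (hP : ContDiffAt ℝ 2 P s) : HasDerivAt (deriv P) (deriv (deriv P) s) s := by
  have h1 : ContDiffAt ℝ 1 (fderiv ℝ P) s := hP.fderiv_right (by norm_num)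
  have h2 : DifferentiableAt ℝ (fun t => fderiv ℝ P t 1) s :=
    (h1.differentiableAt (by norm_num)).clm_apply (differentiableAt_const _)
  exact DifferentiableAt.hasDerivAt (f := deriv P) h2

lemma deriv_eqns {W : Type*} [NormedAddCommGroup W] [NormedSpace ℝ W] (P : ℝ → W)
    (hP : ContDiffAt ℝ 2 P 0) (Q0 Q1 Q2 : W) (L0 L1 L2 : CL W)
    (h : ∀ᶠ t in 𝓝 (0 : ℝ), P t = Q0 + t • Q1 + t ^ 2 • Q2 + L0 (P t) + t • L1 (P t)
      + t ^ 2 • L2 (P t)) :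
    deriv P 0 = Q1 + L1 (P 0) + L0 (deriv P 0) ∧
    deriv (deriv P) 0 = (2 : ℝ) • Q2 + (2 : ℝ) • L1 (deriv P 0) + (2 : ℝ) • L2 (P 0)
      + L0 (deriv (deriv P) 0) := by
  have hdiff : ∀ᶠ t in 𝓝 (0 : ℝ), HasDerivAt P (deriv P t) t := by
    filter_upwards [hP.eventually (by simp)] with t ht
    exact (ht.differentiableAt (by norm_num)).hasDerivAt
  have hd2 : HasDerivAt (deriv P) (deriv (deriv P) 0) 0 := by
    have h1 : ContDiffAt ℝ 1 (fderiv ℝ P) 0 := hP.fderiv_right (by norm_num)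
    have h2 : DifferentiableAt ℝ (fun t => fderiv ℝ P t 1) 0 :=
      (h1.differentiableAt (by norm_num)).clm_apply (differentiableAt_const _)
    exact DifferentiableAt.hasDerivAt (f := deriv P) h2
  have e1 : ∀ᶠ t in 𝓝 (0 : ℝ), deriv P t = Q1 + (2 * t) • Q2 + L0 (deriv P t)
      + (t • L1 (deriv P t) + L1 (P t)) + (t ^ 2 • L2 (deriv P t) + (2 * t) • L2 (P t)) := by
    filter_upwards [h.eventually_nhds, hdiff] with t ht hd
    have hid : HasDerivAt (fun t : ℝ => t) 1 t := hasDerivAt_id t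
    have hsq : HasDerivAt (fun t : ℝ => t ^ 2) (2 * t) t := by simpa using hasDerivAt_pow 2 t
    have hL : ∀ L : CL W, HasDerivAt (fun t => L (P t)) (L (deriv P t)) t := fun L =>
      L.hasFDerivAt.comp_hasDerivAt t hd
    have hr := (((((hasDerivAt_const t Q0).add (hid.smul_const Q1)).add
      (hsq.smul_const Q2)).add (hL L0)).add (hid.smul (hL L1))).add (hsq.smul (hL L2))
    have := hd.unique (hr.congr_of_eventuallyEq ht)
    simp only [zero_add, one_smul] at this
    exact this
  refine ⟨?_, ?_⟩
  · have := e1.self_of_nhds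
    simp only [mul_zero, zero_smul, ne_eq, OfNat.ofNat_ne_zero, not_false_eq_true, zero_pow,
      add_zero, zero_add] at this
    nth_rw 1 [this]; abel
  · have hd := hdiff.self_of_nhds
    have hid : HasDerivAt (fun t : ℝ => t) 1 0 := hasDerivAt_id 0
    have h2t : HasDerivAt (fun t : ℝ => 2 * t) 2 0 := by simpa using hid.const_mul 2
    have hsq : HasDerivAt (fun t : ℝ => t ^ 2) 0 0 := by
      simpa using hasDerivAt_pow 2 (0 : ℝ)
    have hL : ∀ L : CL W, HasDerivAt (fun t => L (P t)) (L (deriv P 0)) 0 := fun L =>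
      L.hasFDerivAt.comp_hasDerivAt 0 hd
    have hL' : ∀ L : CL W, HasDerivAt (fun t => L (deriv P t)) (L (deriv (deriv P) 0)) 0 :=
      fun L => L.hasFDerivAt.comp_hasDerivAt 0 hd2
    have hr := ((((hasDerivAt_const (0 : ℝ) Q1).add (h2t.smul_const Q2)).add (hL' L0)).add
      ((hid.smul (hL' L1)).add (hL L1))).add ((hsq.smul (hL' L2)).add (h2t.smul (hL L2)))
    have := hd2.unique (hr.congr_of_eventuallyEq e1)
    simp only [mul_zero, zero_smul, ne_eq, OfNat.ofNat_ne_zero, not_false_eq_true, zero_pow,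
      add_zero, zero_add, one_smul] at this
    nth_rw 1 [this]; module

lemma line_bound {d k N : ℕ} (hd : 0 < d) (hN : 0 < N)
    (A : Fin N → Matrix (Fin d) (Fin d) ℝ) (B : Fin N → Matrix (Fin d) (Fin k) ℝ)
    (Pr : Matrix (Fin N) (Fin N) ℝ)
    (hPr : ∀ i j, 0 ≤ Pr i j) (hPrSum : ∀ i, ∑ j, Pr i j = 1)
    (piv : Fin N → ℝ) (hpiv : ∀ i, 0 < piv i)
    (Sg : Matrix (Fin d) (Fin d) ℝ) (hSg : Sg.PosDef)
    (Q : Fin N → Matrix (Fin d) (Fin d) ℝ) (hQ : ∀ i, (Q i).PosDef)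
    (R : Fin N → Matrix (Fin k) (Fin k) ℝ) (hR : ∀ i, (R i).PosDef)
    (α : ℝ) (K E : Fin N → Matrix (Fin k) (Fin d) ℝ) (hE : norm2sq E = 1)
    (hK : MSS Pr A B K) (hα : cost Pr A B Q R piv Sg K ≤ α) :
    ContDiffAt ℝ 2 (cost Pr A B Q R piv Sg) K ∧
    |deriv (deriv fun t : ℝ => cost Pr A B Q R piv Sg (K + t • E)) 0| ≤ Lsm B R Q piv Sg α := by
  obtain ⟨hs, hev⟩ := PK_smooth Q R hK
  let ellc : (Fin N → Matrix (Fin d) (Fin d) ℝ) →L[ℝ] ℝ :=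
    LinearMap.toContinuousLinearMap (ell piv Sg)
  have hcost : ∀ K, cost Pr A B Q R piv Sg K = ellc (PK Pr A B Q R K) := fun K => rfl
  have hcs : ContDiffAt ℝ 2 (cost Pr A B Q R piv Sg) K :=
    ellc.contDiff.contDiffAt.comp K hs
  refine ⟨hcs, ?_⟩
  let ln : ℝ → (Fin N → Matrix (Fin k) (Fin d) ℝ) := fun t => K + t • E
  have hln : ContDiff ℝ 2 ln := contDiff_const.add (contDiff_id.smul contDiff_const)
  have hln0 : ln 0 = K := by simp [ln]
  let P : ℝ → (Fin N → Matrix (Fin d) (Fin d) ℝ) := fun t => PK Pr A B Q R (ln t)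
  have hPs : ContDiffAt ℝ 2 P 0 := by
    have : ContDiffAt ℝ 2 (PK Pr A B Q R) (ln 0) := by rw [hln0]; exact hs
    exact this.comp 0 hln.contDiffAt
  set Γ := Gam A B K with hΓ
  let D : Fin N → Matrix (Fin d) (Fin d) ℝ := fun i => B i * E i
  have hG : ∀ t i, Gam A B (ln t) i = Γ i - t • D i := by
    intro t i
    simp only [Gam, hΓ, ln, D, Pi.add_apply, Pi.smul_apply, Matrix.mul_add, Matrix.mul_smul]
    abel
  have hbi : ∀ t V, biL Pr (Gam A B (ln t)) (Gam A B (ln t)) V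
      = biL Pr Γ Γ V + t • (-(biL Pr D Γ V + biL Pr Γ D V)) + t ^ 2 • biL Pr D D V := by
    intro t V
    funext i
    simp only [biL_apply, hG, Pi.add_apply, Pi.smul_apply, Pi.neg_apply, Matrix.transpose_sub,
      Matrix.transpose_smul, Matrix.sub_mul, Matrix.mul_sub, Matrix.smul_mul, Matrix.mul_smul]
    module
  have hsrc : ∀ t, Src Q R (ln t) = (fun i => Q i + (K i)ᵀ * R i * K i)
      + t • (fun i => (E i)ᵀ * R i * K i + (K i)ᵀ * R i * E i)
      + t ^ 2 • (fun i => (E i)ᵀ * R i * E i) := by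
    intro t
    funext i
    simp only [Src, ln, Pi.add_apply, Pi.smul_apply, Matrix.transpose_add,
      Matrix.transpose_smul, Matrix.add_mul, Matrix.mul_add, Matrix.smul_mul, Matrix.mul_smul]
    module
  let c : ((Fin N → Matrix (Fin d) (Fin d) ℝ) →ₗ[ℝ] (Fin N → Matrix (Fin d) (Fin d) ℝ)) →
    CL (Fin N → Matrix (Fin d) (Fin d) ℝ) := fun L => LinearMap.toContinuousLinearMap L
  have hlyap : ∀ᶠ t in 𝓝 (0 : ℝ), IsLyap Pr A B Q R (ln t) (P t) := by
    have : Tendsto ln (𝓝 0) (𝓝 K) := by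
      have := hln.continuous.tendsto 0
      rwa [hln0] at this
    exact this.eventually hev
  have heq : ∀ᶠ t in 𝓝 (0 : ℝ), P t = (fun i => Q i + (K i)ᵀ * R i * K i)
      + t • (fun i => (E i)ᵀ * R i * K i + (K i)ᵀ * R i * E i)
      + t ^ 2 • (fun i => (E i)ᵀ * R i * E i) + c (biL Pr Γ Γ) (P t)
      + t • c (-(biL Pr D Γ + biL Pr Γ D)) (P t) + t ^ 2 • c (biL Pr D D) (P t) := by
    filter_upwards [hlyap] with t ht
    have h1 := isLyap_iff.1 ht
    rw [hbi, hsrc] at h1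
    rw [← add_assoc, ← add_assoc] at h1
    exact h1
  obtain ⟨hP1, hP2⟩ := deriv_eqns P hPs _ _ _ _ _ _ heq
  have hP0 : P 0 = (fun i => Q i + (K i)ᵀ * R i * K i) + biL Pr Γ Γ (P 0) := by
    have := isLyap_iff.1 hlyap.self_of_nhds
    rw [hln0] at this
    exact this
  have hα' : ell piv Sg (P 0) ≤ α := by
    have : P 0 = PK Pr A B Q R K := by simp only [P, hln0]
    rw [this]; exact hα
  have hmain := hess_bound hd hN B Pr hPr hPrSum piv hpiv Sg hSg Q hQ R hR α K E hE Γ D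
    (P 0) (deriv P 0) (deriv (deriv P) 0) (fun i => rfl) hK.stable hP0
    (by
      refine hP1.trans ?_
      change _ + (-(biL Pr D Γ (P 0) + biL Pr Γ D (P 0))) + biL Pr Γ Γ (deriv P 0) = _
      abel)
    (by
      refine hP2.trans ?_
      change _ + (2 : ℝ) • (-(biL Pr D Γ (deriv P 0) + biL Pr Γ D (deriv P 0)))
        + (2 : ℝ) • (biL Pr D D (P 0)) + biL Pr Γ Γ (deriv (deriv P) 0) = _
      module) hα'
  have hd1 : (deriv fun t : ℝ => cost Pr A B Q R piv Sg (K + t • E))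
      =ᶠ[𝓝 0] fun t => ellc (deriv P t) := by
    filter_upwards [hPs.eventually (by simp)] with t ht
    have h1 : HasDerivAt P (deriv P t) t := (ht.differentiableAt (by norm_num)).hasDerivAt
    exact (ellc.hasFDerivAt.comp_hasDerivAt t h1).deriv
  have hd2 : HasDerivAt (deriv P) (deriv (deriv P) 0) 0 := hasDerivAt_deriv_aux hPs
  have hfin : deriv (deriv fun t : ℝ => cost Pr A B Q R piv Sg (K + t • E)) 0
      = ell piv Sg (deriv (deriv P) 0) := by
    rw [hd1.deriv_eq]
    exact (ellc.hasFDerivAt.comp_hasDerivAt 0 hd2).deriv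
  rw [hfin]; exact hmain

lemma taylor_upper (φ : ℝ → ℝ) (n L : ℝ) (hn : 0 ≤ n)
    (hφ : ∀ s ∈ Set.Icc 0 n, ContDiffAt ℝ 2 φ s)
    (hb : ∀ s ∈ Set.Icc 0 n, deriv (deriv φ) s ≤ L) :
    φ n ≤ φ 0 + deriv φ 0 * n + L / 2 * n ^ 2 := by
  have h1 : ∀ s ∈ Set.Icc 0 n, HasDerivAt φ (deriv φ s) s := fun s hs =>
    ((hφ s hs).differentiableAt (by norm_num)).hasDerivAt
  have h2 : ∀ s ∈ Set.Icc 0 n, HasDerivAt (deriv φ) (deriv (deriv φ) s) s := fun s hs => by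
    have h1 : ContDiffAt ℝ 1 (fderiv ℝ φ) s := (hφ s hs).fderiv_right (by norm_num)
    have h2 : DifferentiableAt ℝ (fun t => fderiv ℝ φ t 1) s :=
      (h1.differentiableAt (by norm_num)).clm_apply (differentiableAt_const _)
    exact DifferentiableAt.hasDerivAt (f := deriv φ) h2
  have h3 : ∀ s ∈ Set.Icc 0 n, HasDerivAt (fun s => deriv φ s - L * s)
      (deriv (deriv φ) s - L) s := fun s hs => by
    have := (h2 s hs).sub ((hasDerivAt_id s).const_mul L)
    refine this.congr_deriv ?_
    simp
  have a1 : AntitoneOn (fun s => deriv φ s - L * s) (Set.Icc 0 n) := by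
    refine antitoneOn_of_deriv_nonpos (convex_Icc 0 n)
      (fun s hs => (h3 s hs).continuousAt.continuousWithinAt)
      (fun s hs => (h3 s (interior_subset hs)).differentiableAt.differentiableWithinAt) ?_
    intro s hs
    have hs' := interior_subset hs
    rw [(h3 s hs').deriv]
    linarith [hb s hs']
  have h4 : ∀ s ∈ Set.Icc 0 n, HasDerivAt (fun s => φ s - deriv φ 0 * s - L / 2 * s ^ 2)
      (deriv φ s - deriv φ 0 - L * s) s := fun s hs => by
    have := ((h1 s hs).sub ((hasDerivAt_id s).const_mul (deriv φ 0))).sub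
      ((hasDerivAt_pow 2 s).const_mul (L / 2))
    refine this.congr_deriv ?_
    simp; ring
  have a2 : AntitoneOn (fun s => φ s - deriv φ 0 * s - L / 2 * s ^ 2) (Set.Icc 0 n) := by
    refine antitoneOn_of_deriv_nonpos (convex_Icc 0 n)
      (fun s hs => (h4 s hs).continuousAt.continuousWithinAt)
      (fun s hs => (h4 s (interior_subset hs)).differentiableAt.differentiableWithinAt) ?_
    intro s hs
    have hs' := interior_subset hs
    rw [(h4 s hs').deriv]
    have := a1 (Set.left_mem_Icc.2 hn) hs' hs'.1
    simp only at this
    linarith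
  have := a2 (Set.left_mem_Icc.2 hn) (Set.right_mem_Icc.2 hn) hn
  simp only at this
  linarith

lemma norm2sq_smul {a b N : ℕ} (c : ℝ) (V : Fin N → Matrix (Fin a) (Fin b) ℝ) :
    norm2sq (c • V) = c ^ 2 * norm2sq V := by
  simp only [norm2sq, Pi.smul_apply, Matrix.transpose_smul, Matrix.smul_mul, Matrix.mul_smul,
    Matrix.trace_smul, smul_eq_mul, Finset.mul_sum]
  exact Finset.sum_congr rfl fun i _ => by ring

lemma norm2sq_eq {a b N : ℕ} (V : Fin N → Matrix (Fin a) (Fin b) ℝ) :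
    norm2sq V = ∑ i, ∑ x, ∑ y, V i x y ^ 2 := by
  unfold norm2sq
  refine Finset.sum_congr rfl fun i _ => ?_
  simp only [Matrix.trace, Matrix.diag, Matrix.mul_apply, Matrix.transpose_apply]
  rw [Finset.sum_comm]
  simp [sq]

lemma norm2sq_nonneg {a b N : ℕ} (V : Fin N → Matrix (Fin a) (Fin b) ℝ) : 0 ≤ norm2sq V := by
  rw [norm2sq_eq]; positivity

lemma norm2sq_eq_zero {a b N : ℕ} {V : Fin N → Matrix (Fin a) (Fin b) ℝ} (h : norm2sq V = 0) :
    V = 0 := by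
  rw [norm2sq_eq] at h
  funext i
  ext x y
  have h1 := (Finset.sum_eq_zero_iff_of_nonneg (fun i _ => by positivity)).1 h i (Finset.mem_univ i)
  have h2 := (Finset.sum_eq_zero_iff_of_nonneg (fun i _ => by positivity)).1 h1 x
    (Finset.mem_univ x)
  have h3 := (Finset.sum_eq_zero_iff_of_nonneg (fun i _ => by positivity)).1 h2 y
    (Finset.mem_univ y)
  simpa using h3

lemma deriv_line_aux {W : Type*} [NormedAddCommGroup W] [NormedSpace ℝ W] (f : W → ℝ) (K F : W)
    (hf : DifferentiableAt ℝ f K) : deriv (fun s : ℝ => f (K + s • F)) 0 = fderiv ℝ f K F := by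
  have hl : HasDerivAt (fun s : ℝ => K + s • F) F 0 := by
    have := ((hasDerivAt_id (0 : ℝ)).smul_const F).const_add K
    refine this.congr_deriv ?_
    simp
  have hf' : HasFDerivAt f (fderiv ℝ f K) (K + (0 : ℝ) • F) := by
    rw [zero_smul, add_zero]; exact hf.hasFDerivAt
  exact (hf'.comp_hasDerivAt (0 : ℝ) hl).deriv

/-- smoothness on sublevel sets. -/
theorem smoothness_on_sublevel_sets
    (d k N : ℕ) (hd : 0 < d) (hk : 0 < k) (hN : 0 < N)
    (A : Fin N → Matrix (Fin d) (Fin d) ℝ) (B : Fin N → Matrix (Fin d) (Fin k) ℝ)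
    (Pr : Matrix (Fin N) (Fin N) ℝ)
    (hPr : ∀ i j, 0 ≤ Pr i j) (hPrSum : ∀ i, ∑ j, Pr i j = 1)
    (piv : Fin N → ℝ) (hpiv : ∀ i, 0 < piv i) (hpivSum : ∑ i, piv i = 1)
    (Sg : Matrix (Fin d) (Fin d) ℝ) (hSg : Sg.PosDef)
    (Q : Fin N → Matrix (Fin d) (Fin d) ℝ) (hQ : ∀ i, (Q i).PosDef)
    (R : Fin N → Matrix (Fin k) (Fin k) ℝ) (hR : ∀ i, (R i).PosDef)
    (α : ℝ) (hα : 0 < α) :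
    (∀ K : Fin N → Matrix (Fin k) (Fin d) ℝ, MSS Pr A B K → cost Pr A B Q R piv Sg K ≤ α →
      ∀ E : Fin N → Matrix (Fin k) (Fin d) ℝ, Real.sqrt (norm2sq E) = 1 →
        |deriv (deriv fun t : ℝ => cost Pr A B Q R piv Sg (K + t • E)) 0| ≤ Lsm B R Q piv Sg α) ∧
    ∀ K K' : Fin N → Matrix (Fin k) (Fin d) ℝ,
      (∀ t : ℝ, t ∈ Set.Icc (0 : ℝ) 1 →
        MSS Pr A B (t • K' + (1 - t) • K) ∧ cost Pr A B Q R piv Sg (t • K' + (1 - t) • K) ≤ α) →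
      cost Pr A B Q R piv Sg K'
        ≤ cost Pr A B Q R piv Sg K + fderiv ℝ (cost Pr A B Q R piv Sg) K (K' - K)
          + Lsm B R Q piv Sg α / 2 * norm2sq (K' - K) := by
  refine ⟨fun K hK hc E hE => (line_bound hd hN A B Pr hPr hPrSum piv hpiv Sg hSg Q hQ R hR α K E
    (Real.sqrt_eq_one.1 hE) hK hc).2, ?_⟩
  intro K K' hseg
  set n := Real.sqrt (norm2sq (K' - K)) with hn
  have hn2 : n ^ 2 = norm2sq (K' - K) := Real.sq_sqrt (norm2sq_nonneg _)
  rcases (Real.sqrt_nonneg (norm2sq (K' - K))).eq_or_lt with h0 | hpos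
  · rw [← hn] at h0
    have h1 : norm2sq (K' - K) = 0 := by rw [← hn2, ← h0]; norm_num
    have h2 : K' - K = 0 := norm2sq_eq_zero h1
    have h3 : K' = K := sub_eq_zero.1 h2
    rw [h1, h2, h3]; simp
  rw [← hn] at hpos
  let F : Fin N → Matrix (Fin k) (Fin d) ℝ := n⁻¹ • (K' - K)
  have hF : norm2sq F = 1 := by
    simp only [F]; rw [norm2sq_smul, ← hn2]; field_simp
  have hnF : n • F = K' - K := by simp only [F]; rw [smul_smul, mul_inv_cancel₀ hpos.ne', one_smul]
  have hmem : ∀ s ∈ Set.Icc 0 n, MSS Pr A B (K + s • F) ∧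
      cost Pr A B Q R piv Sg (K + s • F) ≤ α := by
    intro s hs
    have h1 := hseg (s / n) ⟨div_nonneg hs.1 hpos.le, (div_le_one hpos).2 hs.2⟩
    have h2 : (s / n) • K' + (1 - s / n) • K = K + s • F := by
      simp only [F]; rw [smul_smul, ← div_eq_mul_inv]; module
    rwa [h2] at h1
  have hlb := fun s hs => line_bound hd hN A B Pr hPr hPrSum piv hpiv Sg hSg Q hQ R hR α
    (K + s • F) F hF (hmem s hs).1 (hmem s hs).2
  let φ : ℝ → ℝ := fun s => cost Pr A B Q R piv Sg (K + s • F)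
  have hln : ContDiff ℝ 2 fun s : ℝ => K + s • F :=
    contDiff_const.add (contDiff_id.smul contDiff_const)
  have hT := taylor_upper φ n (Lsm B R Q piv Sg α) hpos.le
    (fun s hs => ContDiffAt.comp (g := cost Pr A B Q R piv Sg) (f := fun s : ℝ => K + s • F) s
      (hlb s hs).1 hln.contDiffAt)
    (fun s hs => by
      have h1 := (abs_le.1 (hlb s hs).2).2
      have h2 : (fun t : ℝ => cost Pr A B Q R piv Sg (K + s • F + t • F))
          = fun t => φ (s + t) := by
        funext t; simp only [φ]; rw [add_smul, add_assoc]
      rw [h2] at h1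
      have h3 : deriv (fun t => φ (s + t)) = fun t => deriv φ (s + t) := by
        funext t; exact deriv_comp_const_add φ s t
      rw [h3, deriv_comp_const_add (deriv φ) s 0, add_zero] at h1
      exact h1)
  have e0 : φ 0 = cost Pr A B Q R piv Sg K := by simp [φ]
  have e1 : φ n = cost Pr A B Q R piv Sg K' := by simp only [φ]; rw [hnF]; simp
  have e2 : deriv φ 0 * n = fderiv ℝ (cost Pr A B Q R piv Sg) K (K' - K) := by
    have h0 := (hlb 0 ⟨le_rfl, hpos.le⟩).1
    rw [zero_smul, add_zero] at h0
    have h1 : deriv φ 0 = fderiv ℝ (cost Pr A B Q R piv Sg) K F :=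
      deriv_line_aux (cost Pr A B Q R piv Sg) K F (h0.differentiableAt (by norm_num))
    rw [h1, ← hnF, mul_comm]
    exact (ContinuousLinearMap.map_smul (fderiv ℝ (cost Pr A B Q R piv Sg) K) n F).symm
  rw [e0, e1, e2, hn2] at hT
  exact hT

end MJLS
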